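/- arXiv:1805.05534 — 11 statements merged into one kernel-verified Lean document; each statement's English description precedes it below -/
import Mathlib

section
/- Let E be a real inner product space and let τ, ψ ∈ E be unit vectors with ⟪τ, ψ⟫ = sin θ for some θ ∈ (0, π/2). Define the oracle reflection S_τ(x) = x − 2⟪τ, x⟫τ and the Grover iteration Q(x) = 2⟪ψ, S_τ(x)⟫ψ − S_τ(x) (that is, Q = (2ψψ* − I) ∘ S_τ). Then for every natural number i, ⟪τ, Q^i(ψ)⟫ = sin((2i+1)θ); in particular the success probability of measuring a target after i Grover iterations starting from the initial state ψ is sin²((2i+1)θ). -/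
open scoped RealInnerProductSpace

/-- Success amplitude of Grover's algorithm: after `i` Grover iterations starting from the
initial state `ψ`, the overlap with the target state `τ` is `sin ((2i+1)θ)`. -/
theorem grover_amplitude {E : Type*} [NormedAddCommGroup E] [InnerProductSpace ℝ E]
    (τ ψ : E) (hτ : ‖τ‖ = 1) (hψ : ‖ψ‖ = 1)
    (θ : ℝ) (hθ : θ ∈ Set.Ioo 0 (Real.pi / 2))
    (hover : ⟪τ, ψ⟫ = Real.sin θ)
    (S Q : E → E)
    (hS : ∀ x, S x = x - (2 * ⟪τ, x⟫) • τ)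
    (hQ : ∀ x, Q x = (2 * ⟪ψ, S x⟫) • ψ - S x) :
    ∀ i : ℕ, ⟪τ, Q^[i] ψ⟫ = Real.sin ((2 * i + 1) * θ) := by
  have hττ : ⟪τ, τ⟫ = 1 := by rw [real_inner_self_eq_norm_sq, hτ]; norm_num
  have hψψ : ⟪ψ, ψ⟫ = 1 := by rw [real_inner_self_eq_norm_sq, hψ]; norm_num
  have hover2 : ⟪ψ, τ⟫ = Real.sin θ := by rw [real_inner_comm, hover]
  have key : ∀ i : ℕ, ⟪τ, Q^[i] ψ⟫ = Real.sin ((2 * i + 1) * θ) ∧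
      ⟪ψ, Q^[i] ψ⟫ = Real.cos ((2 * i) * θ) := by
    intro i
    induction i with
    | zero => simp [hover, hψ]
    | succ k ih =>
      obtain ⟨ha, hb⟩ := ih
      have hc : Real.cos (2 * k * θ) - 2 * Real.sin ((2 * k + 1) * θ) * Real.sin θ
          = Real.cos ((2 * k + 2) * θ) := by
        have e1 : 2 * k * θ = (2 * k + 1) * θ - θ := by ring
        have e2 : (2 * k + 2) * θ = (2 * k + 1) * θ + θ := by ring
        rw [e1, e2, Real.cos_sub, Real.cos_add]; ring
      have hs : 2 * Real.cos ((2 * k + 2) * θ) * Real.sin θ + Real.sin ((2 * k + 1) * θ)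
          = Real.sin ((2 * k + 3) * θ) := by
        have e1 : (2 * k + 1) * θ = (2 * k + 2) * θ - θ := by ring
        have e2 : (2 * k + 3) * θ = (2 * k + 2) * θ + θ := by ring
        rw [e1, e2, Real.sin_sub, Real.sin_add]; ring
      have c1 : (2 * ((k + 1 : ℕ) : ℝ) + 1) * θ = (2 * k + 3) * θ := by push_cast; ring
      have c2 : (2 * ((k + 1 : ℕ) : ℝ)) * θ = (2 * k + 2) * θ := by push_cast; ring
      rw [Function.iterate_succ_apply', hQ, hS, c1, c2, ← hs, ← hc]
      simp only [inner_sub_right, inner_smul_right, hττ, hψψ, hover, hover2, ha, hb]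
      constructor <;> ring
  exact fun i => (key i).1
end

section
/- There exists a unique z ∈ (0, π/2) satisfying tan z = 2z, and this root lies in the open interval (1.16, 1.17). -/
open Real in
lemma aux_conv : StrictConvexOn ℝ (Set.Icc 0 (π / 2)) (fun z : ℝ => sin z - 2 * z * cos z) := by
  have h1 : ∀ z : ℝ, HasDerivAt (fun z : ℝ => sin z - 2 * z * cos z)
      (2 * z * sin z - cos z) z := by
    intro z
    have := (hasDerivAt_sin z).sub ((((hasDerivAt_id z).const_mul 2)).mul (hasDerivAt_cos z))
    exact this.congr_deriv (by simp only [id]; ring)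
  have h2 : ∀ z : ℝ, HasDerivAt (fun z : ℝ => 2 * z * sin z - cos z)
      (3 * sin z + 2 * z * cos z) z := by
    intro z
    have := ((((hasDerivAt_id z).const_mul 2)).mul (hasDerivAt_sin z)).sub (hasDerivAt_cos z)
    exact this.congr_deriv (by simp only [id]; ring)
  apply strictConvexOn_of_deriv2_pos (convex_Icc _ _)
  · fun_prop
  · intro x hx
    rw [interior_Icc] at hx
    have e : deriv (fun z : ℝ => sin z - 2 * z * cos z) = fun z => 2 * z * sin z - cos z :=
      funext fun z => (h1 z).deriv
    simp only [Function.iterate_succ, Function.iterate_zero, Function.comp, id]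
    rw [e, (h2 x).deriv]
    have hs : 0 < sin x := sin_pos_of_pos_of_lt_pi hx.1 (by linarith [hx.2, pi_pos])
    have hc : 0 < cos x := cos_pos_of_mem_Ioo ⟨by linarith [hx.1, pi_pos], hx.2⟩
    have := hx.1
    positivity

open Real in
lemma aux_neg {a b : ℝ} (ha : 0 < a) (hab : a < b) (hb : b ≤ π / 2)
    (h : sin b - 2 * b * cos b ≤ 0) : sin a - 2 * a * cos a < 0 := by
  have hb0 : 0 < b := ha.trans hab
  have hconv := aux_conv.2
  have := @hconv 0 ⟨le_rfl, by positivity⟩ b ⟨hb0.le, hb⟩ hb0.ne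
    (1 - a / b) (a / b) (by rw [sub_pos, div_lt_one hb0]; exact hab)
    (by positivity) (by ring)
  have e : a / b * b = a := by field_simp
  simp only [smul_eq_mul, mul_zero, zero_add, sin_zero, zero_mul, sub_zero, e] at this
  have h3 : a / b * (sin b - 2 * b * cos b) ≤ 0 :=
    mul_nonpos_of_nonneg_of_nonpos (by positivity) h
  linarith

open Real in
lemma aux_116 : sin 1.16 - 2 * 1.16 * cos 1.16 < 0 := by
  have p1 := pi_gt_d4
  have p2 := pi_lt_d4
  have s : sin 0.4107 ≤ sin (π / 2 - 1.16) :=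
    sin_le_sin_of_le_of_le_pi_div_two (by linarith) (by linarith) (by linarith)
  have c : cos (π / 2 - 1.16) ≤ cos 0.4107 :=
    cos_le_cos_of_nonneg_of_le_pi (by norm_num) (by linarith) (by linarith)
  rw [sin_pi_div_two_sub] at s
  rw [cos_pi_div_two_sub] at c
  have s' := (abs_le.1 (sin_bound (x := 0.4107) (by norm_num [abs_le]))).1
  have c' := (abs_le.1 (cos_bound (x := 0.4107) (by norm_num [abs_le]))).2
  rw [abs_of_pos (by norm_num)] at s' c'
  norm_num at s' c' s c ⊢
  linarith

open Real in
lemma aux_117 : 0 < sin 1.17 - 2 * 1.17 * cos 1.17 := by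
  have p1 := pi_gt_d4
  have p2 := pi_lt_d4
  have s : sin (π / 2 - 1.17) ≤ sin 0.4008 :=
    sin_le_sin_of_le_of_le_pi_div_two (by linarith) (by linarith) (by linarith)
  have c : cos 0.4008 ≤ cos (π / 2 - 1.17) :=
    cos_le_cos_of_nonneg_of_le_pi (by linarith) (by linarith) (by linarith)
  rw [sin_pi_div_two_sub] at s
  rw [cos_pi_div_two_sub] at c
  have s' := (abs_le.1 (sin_bound (x := 0.4008) (by norm_num [abs_le]))).2
  have c' := (abs_le.1 (cos_bound (x := 0.4008) (by norm_num [abs_le]))).1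
  rw [abs_of_pos (by norm_num)] at s' c'
  norm_num at s' c' s c ⊢
  linarith

open Real in
lemma aux_iff {z : ℝ} (hz : z ∈ Set.Ioo 0 (π / 2)) :
    tan z = 2 * z ↔ sin z - 2 * z * cos z = 0 := by
  have hc : 0 < cos z := cos_pos_of_mem_Ioo ⟨by linarith [hz.1, pi_pos], hz.2⟩
  rw [tan_eq_sin_div_cos, div_eq_iff hc.ne', sub_eq_zero]

/-- There is a unique `z ∈ (0, π/2)` with `tan z = 2z`, and it lies in `(1.16, 1.17)`. -/
theorem tan_eq_two_mul_unique_root :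
    (∃! z : ℝ, z ∈ Set.Ioo 0 (Real.pi / 2) ∧ Real.tan z = 2 * z) ∧
    (∀ z ∈ Set.Ioo 0 (Real.pi / 2), Real.tan z = 2 * z →
      z ∈ Set.Ioo (1.16 : ℝ) 1.17) := by
  have p1 := Real.pi_gt_d4
  have h6 := aux_116
  have h7 := aux_117
  constructor
  · have hcont : ContinuousOn (fun z : ℝ => Real.sin z - 2 * z * Real.cos z)
        (Set.Icc (1.16 : ℝ) 1.17) := by fun_prop
    obtain ⟨z, hz, hz0⟩ := intermediate_value_Icc (by norm_num) hcont ⟨h6.le, h7.le⟩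
    have hzI : z ∈ Set.Ioo 0 (Real.pi / 2) := ⟨by linarith [hz.1], by linarith [hz.2]⟩
    refine ⟨z, ⟨hzI, (aux_iff hzI).2 hz0⟩, ?_⟩
    rintro y ⟨hy, hyt⟩
    have hy0 := (aux_iff hy).1 hyt
    rcases lt_trichotomy y z with h | h | h
    · exact absurd hy0 (aux_neg hy.1 h hzI.2.le hz0.le).ne
    · exact h
    · exact absurd hz0 (aux_neg hzI.1 h hy.2.le hy0.le).ne
  · intro z hz ht
    have h0 := (aux_iff hz).1 ht
    constructor
    · by_contra! h
      rcases h.lt_or_eq with h | h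
      · exact absurd h0 (aux_neg hz.1 h (by linarith) h6.le).ne
      · rw [← h] at h6
        exact h6.ne h0
    · by_contra! h
      rcases h.lt_or_eq with h | h
      · exact absurd h7 (aux_neg (by norm_num) h hz.2.le h0.le).le.not_gt
      · rw [h] at h7
        exact h7.ne' h0
end

section
/- The function z ↦ z/(2 sin² z) on the interval (0, π) attains a global minimum; the minimum is attained exactly at the unique root z₀ ∈ (0, π/2) of tan z = 2z, and the minimum value lies in the open interval (0.689, 0.691). (This is the constant in the optimal expected Grover iteration count I_{t,N} = 0.690…·√(N/t) for t targets in a domain of size N.) -/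
lemma gr_hd (z : ℝ) : HasDerivAt (fun z : ℝ => Real.sin z - 2 * z * Real.cos z)
    (2 * z * Real.sin z - Real.cos z) z := by
  have := (Real.hasDerivAt_sin z).sub
    ((((hasDerivAt_id z).const_mul 2)).mul (Real.hasDerivAt_cos z))
  refine this.congr_deriv ?_
  simp; ring

lemma gr_hd2 (z : ℝ) : HasDerivAt (fun z : ℝ => 2 * z * Real.sin z - Real.cos z)
    (3 * Real.sin z + 2 * z * Real.cos z) z := by
  have := ((((hasDerivAt_id z).const_mul 2)).mul (Real.hasDerivAt_sin z)).sub
    (Real.hasDerivAt_cos z)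
  refine this.congr_deriv ?_
  simp; ring

lemma gr_convex : StrictConvexOn ℝ (Set.Icc 0 (Real.pi / 2))
    (fun z : ℝ => Real.sin z - 2 * z * Real.cos z) := by
  apply strictConvexOn_of_deriv2_pos (convex_Icc _ _)
  · exact fun z _ => (gr_hd z).continuousAt.continuousWithinAt
  · intro x hx
    rw [interior_Icc] at hx
    have h1 : deriv (fun z : ℝ => Real.sin z - 2 * z * Real.cos z)
        = fun z => 2 * z * Real.sin z - Real.cos z := funext fun z => (gr_hd z).deriv
    simp only [Function.iterate_succ, Function.iterate_zero, Function.comp, id]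
    rw [h1, (gr_hd2 x).deriv]
    have h2 := Real.sin_pos_of_pos_of_lt_pi hx.1 (by linarith [hx.2, Real.pi_pos])
    have h3 := Real.cos_pos_of_mem_Ioo ⟨by linarith [hx.1, Real.pi_pos], hx.2⟩
    have := hx.1
    positivity

lemma gr_fd (z : ℝ) (hz : z ∈ Set.Ioo 0 Real.pi) :
    HasDerivAt (fun z : ℝ => z / (2 * Real.sin z ^ 2))
    ((Real.sin z - 2 * z * Real.cos z) / (2 * Real.sin z ^ 3)) z := by
  have hs := Real.sin_pos_of_pos_of_lt_pi hz.1 hz.2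
  have := (hasDerivAt_id z).div (((Real.hasDerivAt_sin z).pow 2).const_mul 2) (by
    simp; exact hs.ne')
  refine this.congr_deriv ?_
  simp
  field_simp

/-- The function `z ↦ z / (2 sin² z)` attains a global minimum on `(0, π)`, exactly at the
unique root `z₀ ∈ (0, π/2)` of `tan z = 2z`, with minimum value in `(0.689, 0.691)`. -/
theorem grover_expected_iteration_constant :
    ∃ z₀ ∈ Set.Ioo (0 : ℝ) Real.pi,
      (∀ z ∈ Set.Ioo (0 : ℝ) Real.pi,
        z₀ / (2 * Real.sin z₀ ^ 2) ≤ z / (2 * Real.sin z ^ 2)) ∧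
      (∀ z ∈ Set.Ioo (0 : ℝ) Real.pi,
        z / (2 * Real.sin z ^ 2) = z₀ / (2 * Real.sin z₀ ^ 2) → z = z₀) ∧
      z₀ ∈ Set.Ioo 0 (Real.pi / 2) ∧ Real.tan z₀ = 2 * z₀ ∧
      (∀ z ∈ Set.Ioo 0 (Real.pi / 2), Real.tan z = 2 * z → z = z₀) ∧
      z₀ / (2 * Real.sin z₀ ^ 2) ∈ Set.Ioo (0.689 : ℝ) 0.691 := by
  have p1 := Real.pi_gt_d6
  have p2 := Real.pi_lt_d6
  set h : ℝ → ℝ := fun z : ℝ => Real.sin z - 2 * z * Real.cos z with hh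
  have hcont : Continuous h := by rw [hh]; fun_prop
  have ha : h (Real.pi / 2 - 0.4074) < 0 := by
    simp only [hh, Real.sin_pi_div_two_sub, Real.cos_pi_div_two_sub]
    have c := abs_le.1 (Real.cos_bound (x := 0.4074) (by norm_num [abs_le]))
    have s := abs_le.1 (Real.sin_bound (x := 0.4074) (by norm_num [abs_le]))
    rw [abs_of_pos (by norm_num)] at c s
    norm_num at c s ⊢
    nlinarith [c.2, s.1]
  have hb : 0 < h (Real.pi / 2 - 0.4030) := by
    simp only [hh, Real.sin_pi_div_two_sub, Real.cos_pi_div_two_sub]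
    have c := abs_le.1 (Real.cos_bound (x := 0.4030) (by norm_num [abs_le]))
    have s := abs_le.1 (Real.sin_bound (x := 0.4030) (by norm_num [abs_le]))
    rw [abs_of_pos (by norm_num)] at c s
    norm_num at c s ⊢
    nlinarith [c.1, s.2, s.1]
  obtain ⟨z₀, hz, h0⟩ := intermediate_value_Ioo (by norm_num; linarith : Real.pi / 2 - 0.4074 ≤ Real.pi / 2 - 0.4030)
    hcont.continuousOn ⟨ha, hb⟩
  obtain ⟨hz1, hz2⟩ := hz
  norm_num at hz1 hz2
  have hzl : 1.16339 < z₀ := by norm_num; linarith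
  have hzu : z₀ < 1.1678 := by norm_num; linarith
  have hz0 : 0 < z₀ := by linarith
  have hzp : z₀ < Real.pi / 2 := by linarith
  have h00 : h 0 = 0 := by simp [hh]
  have hneg : ∀ z, 0 < z → z < z₀ → h z < 0 := by
    intro z a b
    have := gr_convex.slope_strict_mono_adjacent (x := 0) (y := z) (z := z₀)
      ⟨le_rfl, by linarith⟩ ⟨by linarith, by linarith⟩ a b
    change (h z - h 0) / (z - 0) < (h z₀ - h z) / (z₀ - z) at this
    rw [h00, h0] at this
    by_contra hc
    push Not at hc
    have e1 : 0 ≤ (h z - 0) / (z - 0) := div_nonneg (by linarith) (by linarith)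
    have e2 : (0 - h z) / (z₀ - z) ≤ 0 := div_nonpos_of_nonpos_of_nonneg (by linarith) (by linarith)
    linarith
  have hpos : ∀ z, z₀ < z → z < Real.pi → 0 < h z := by
    intro z a b
    rcases lt_or_ge z (Real.pi / 2) with c | c
    · have := gr_convex.slope_strict_mono_adjacent (x := 0) (y := z₀) (z := z)
        ⟨le_rfl, by linarith⟩ ⟨by linarith, by linarith⟩ hz0 a
      change (h z₀ - h 0) / (z₀ - 0) < (h z - h z₀) / (z - z₀) at this
      rw [h00, h0] at this
      by_contra hc
      push Not at hc
      have e2 : (h z - 0) / (z - z₀) ≤ 0 := div_nonpos_of_nonpos_of_nonneg (by linarith) (by linarith)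
      simp at this e2
      linarith
    · have s := Real.sin_pos_of_pos_of_lt_pi (by linarith : 0 < z) b
      have k := Real.cos_nonpos_of_pi_div_two_le_of_le c (by linarith)
      simp only [hh]
      nlinarith
  have key : ∀ z ∈ Set.Ioo (0 : ℝ) Real.pi, z ≠ z₀ →
      z₀ / (2 * Real.sin z₀ ^ 2) < z / (2 * Real.sin z ^ 2) := by
    intro z hz hne
    rcases lt_or_gt_of_ne hne with c | c
    · have : StrictAntiOn (fun z : ℝ => z / (2 * Real.sin z ^ 2)) (Set.Icc z z₀) := by
        apply strictAntiOn_of_deriv_neg (convex_Icc _ _)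
        · exact fun x hx => (gr_fd x ⟨by linarith [hx.1, hz.1], by linarith [hx.2]⟩).continuousAt.continuousWithinAt
        · intro x hx
          rw [interior_Icc] at hx
          have hx' : x ∈ Set.Ioo 0 Real.pi := ⟨by linarith [hx.1, hz.1], by linarith [hx.2]⟩
          have s := Real.sin_pos_of_pos_of_lt_pi hx'.1 hx'.2
          rw [(gr_fd x hx').deriv]
          exact div_neg_of_neg_of_pos (hneg x hx'.1 hx.2) (by positivity)
      exact this ⟨le_rfl, c.le⟩ ⟨c.le, le_rfl⟩ c
    · have : StrictMonoOn (fun z : ℝ => z / (2 * Real.sin z ^ 2)) (Set.Icc z₀ z) := by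
        apply strictMonoOn_of_deriv_pos (convex_Icc _ _)
        · exact fun x hx => (gr_fd x ⟨by linarith [hx.1], by linarith [hx.2, hz.2]⟩).continuousAt.continuousWithinAt
        · intro x hx
          rw [interior_Icc] at hx
          have hx' : x ∈ Set.Ioo 0 Real.pi := ⟨by linarith [hx.1], by linarith [hx.2, hz.2]⟩
          have s := Real.sin_pos_of_pos_of_lt_pi hx'.1 hx'.2
          rw [(gr_fd x hx').deriv]
          exact div_pos (hpos x hx.1 hx'.2) (by positivity)
      exact this ⟨le_rfl, c.le⟩ ⟨c.le, le_rfl⟩ c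
  have hc0 := Real.cos_pos_of_mem_Ioo (x := z₀) ⟨by linarith, hzp⟩
  have hs0 := Real.sin_pos_of_pos_of_lt_pi hz0 (by linarith)
  have hsc : Real.sin z₀ = 2 * z₀ * Real.cos z₀ := by
    simp only [hh] at h0; linarith
  refine ⟨z₀, ⟨hz0, by linarith⟩, ?_, ?_, ⟨hz0, hzp⟩, ?_, ?_, ?_⟩
  · intro z hz
    by_cases e : z = z₀
    · rw [e]
    · exact (key z hz e).le
  · intro z hz e
    by_contra hne
    exact (key z hz hne).ne' e
  · rw [Real.tan_eq_sin_div_cos, hsc]; field_simp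
  · intro z hz e
    have hc := Real.cos_pos_of_mem_Ioo (x := z) ⟨by linarith [hz.1], hz.2⟩
    rw [Real.tan_eq_sin_div_cos, div_eq_iff hc.ne'] at e
    have e' : h z = 0 := by simp only [hh]; linarith
    rcases lt_trichotomy z z₀ with c | c | c
    · linarith [hneg z hz.1 c]
    · exact c
    · linarith [hpos z c (by linarith [hz.2])]
  · have hsq : Real.sin z₀ ^ 2 * (1 + 4 * z₀ ^ 2) = 4 * z₀ ^ 2 := by
      have := Real.sin_sq_add_cos_sq z₀
      have h2 : Real.sin z₀ ^ 2 = 4 * z₀ ^ 2 * Real.cos z₀ ^ 2 := by rw [hsc]; ring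
      linear_combination h2 + 4 * z₀ ^ 2 * this
    have hv : z₀ / (2 * Real.sin z₀ ^ 2) = (1 + 4 * z₀ ^ 2) / (8 * z₀) := by
      rw [div_eq_div_iff (by positivity) (by positivity)]
      linear_combination -2 * hsq
    rw [hv]
    norm_num at hzl hzu
    constructor
    · rw [lt_div_iff₀ (by positivity)]
      norm_num
      nlinarith
    · rw [div_lt_iff₀ (by positivity)]
      norm_num
      nlinarith
end

section
/- Define P : ℝ → ℝ by P(x) = ∑_{t=1}^{∞} (e^(−1)/t!)·sin²(2·√t·x). Then the function g(x) = x/P(x) on the interval (0, 1] attains its minimum at some point x* lying in the open interval (0.43, 0.44), and the minimum value g(x*) lies in the open interval (0.951, 0.952). (Proposition 1: the optimal expected number of Grover iterations for key search of a random function is I_rand^KS = 0.951…·√N, attained at i_rand^KS = 0.434…·√N.) -/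
/-- The limiting success probability of Grover key search for a random function:
`P(x) = ∑_{t ≥ 1} (e⁻¹ / t!) · sin²(2 √t x)`. -/
noncomputable def groverKSProb (x : ℝ) : ℝ :=
  ∑' t : ℕ, Real.exp (-1) / (Nat.factorial (t + 1) : ℝ) *
    Real.sin (2 * Real.sqrt ((t : ℝ) + 1) * x) ^ 2

open Real Finset in
lemma grover_trig (n : ℕ) : ∀ x : ℝ, 0 ≤ x →
    0 ≤ (-1 : ℝ) ^ n * (cos x - ∑ k ∈ range n, (-1 : ℝ) ^ k * x ^ (2 * k) / (Nat.factorial (2 * k) : ℝ)) ∨ n = 0 := by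
  have step : ∀ f g : ℝ → ℝ, f 0 = 0 → (∀ x, HasDerivAt f (g x) x) → (∀ x, 0 ≤ x → 0 ≤ g x) →
      ∀ x, 0 ≤ x → 0 ≤ f x := by
    intro f g h0 hd hg x hx
    have hm : MonotoneOn f (Set.Ici 0) := by
      apply monotoneOn_of_deriv_nonneg (convex_Ici 0)
      · exact fun y _ => (hd y).continuousAt.continuousWithinAt
      · exact fun y _ => (hd y).differentiableAt.differentiableWithinAt
      · intro y hy
        rw [(hd y).deriv]
        rw [interior_Ici] at hy
        exact hg y (le_of_lt hy)
    have := hm (Set.mem_Ici.2 le_rfl) (Set.mem_Ici.2 hx) hx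
    linarith
  have dS : ∀ (n : ℕ) (x : ℝ), HasDerivAt
      (fun x => ∑ k ∈ range n, (-1 : ℝ) ^ k * x ^ (2 * k + 1) / (Nat.factorial (2 * k + 1) : ℝ))
      (∑ k ∈ range n, (-1 : ℝ) ^ k * x ^ (2 * k) / (Nat.factorial (2 * k) : ℝ)) x := by
    intro n x
    apply HasDerivAt.fun_sum
    intro k _
    have := ((hasDerivAt_pow (2 * k + 1) x).const_mul ((-1 : ℝ) ^ k)).div_const
      (Nat.factorial (2 * k + 1) : ℝ)
    refine this.congr_deriv ?_
    rw [Nat.factorial_succ]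
    have : (Nat.factorial (2 * k) : ℝ) ≠ 0 := by positivity
    push_cast
    try simp only [Nat.add_sub_cancel]
    field_simp
  have dC : ∀ (n : ℕ) (x : ℝ), HasDerivAt
      (fun x => ∑ k ∈ range (n + 1), (-1 : ℝ) ^ k * x ^ (2 * k) / (Nat.factorial (2 * k) : ℝ))
      (-∑ k ∈ range n, (-1 : ℝ) ^ k * x ^ (2 * k + 1) / (Nat.factorial (2 * k + 1) : ℝ)) x := by
    intro n x
    have e : (fun x : ℝ => ∑ k ∈ range (n + 1), (-1 : ℝ) ^ k * x ^ (2 * k) / (Nat.factorial (2 * k) : ℝ))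
      = fun x => ∑ k ∈ range n, (-1 : ℝ) ^ (k + 1) * x ^ (2 * k + 1 + 1) / (Nat.factorial (2 * k + 1 + 1) : ℝ) + 1 := by
      funext y
      rw [sum_range_succ']
      simp [mul_add]
    rw [e, ← sum_neg_distrib]
    apply HasDerivAt.add_const
    apply HasDerivAt.fun_sum
    intro k _
    have := ((hasDerivAt_pow (2 * k + 1 + 1) x).const_mul ((-1 : ℝ) ^ (k + 1))).div_const
      (Nat.factorial (2 * k + 1 + 1) : ℝ)
    refine this.congr_deriv ?_
    rw [Nat.factorial_succ (2 * k + 1)]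
    have : (Nat.factorial (2 * k + 1) : ℝ) ≠ 0 := by positivity
    push_cast
    try simp only [Nat.add_sub_cancel]
    field_simp
    ring
  have main : ∀ n : ℕ, ∀ x : ℝ, 0 ≤ x →
    0 ≤ (-1 : ℝ) ^ (n + 1) * (cos x - ∑ k ∈ range (n + 1), (-1 : ℝ) ^ k * x ^ (2 * k) / (Nat.factorial (2 * k) : ℝ)) := by
    intro n
    induction n with
    | zero => intro x _; simp; exact cos_le_one x
    | succ n ih =>
      have hs := step (fun x => (-1 : ℝ) ^ (n + 1) * (sin x - ∑ k ∈ range (n + 1), (-1 : ℝ) ^ k * x ^ (2 * k + 1) / (Nat.factorial (2 * k + 1) : ℝ))) _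
        (by simp) (fun x => ((hasDerivAt_sin x).sub (dS (n + 1) x)).const_mul _) ih
      have hc := step (fun x => (-1 : ℝ) ^ (n + 1 + 1) * (cos x - ∑ k ∈ range (n + 1 + 1), (-1 : ℝ) ^ k * x ^ (2 * k) / (Nat.factorial (2 * k) : ℝ))) _
        (by rw [sum_range_succ']; simp) (fun x => ((hasDerivAt_cos x).sub (dC (n + 1) x)).const_mul _)
        (fun x hx => by
          have := hs x hx
          rw [pow_succ]; linarith)
      exact hc
  intro x hx
  cases n with
  | zero => exact Or.inr rfl
  | succ n => exact Or.inl (main n x hx)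

/-- Bell numbers as reals. -/
noncomputable def groverBell : ℕ → ℝ
  | 0 => 1
  | n + 1 => ∑ j : Fin (n + 1), (Nat.choose n j : ℝ) * groverBell j

lemma groverBell_zero : groverBell 0 = 1 := by rw [groverBell]
lemma groverBell_1 : groverBell 1 = 1 := by
  rw [groverBell]; simp [groverBell_zero]
lemma groverBell_2 : groverBell 2 = 2 := by
  rw [groverBell]; simp [Fin.sum_univ_succ, groverBell_zero, groverBell_1]; norm_num
lemma groverBell_succ (n : ℕ) : groverBell (n + 1) =
    ∑ j ∈ Finset.range (n + 1), (Nat.choose n j : ℝ) * groverBell j := by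
  rw [groverBell, Finset.sum_range]
lemma groverBell_3 : groverBell 3 = 5 := by
  rw [groverBell_succ]
  norm_num [Finset.sum_range_succ, groverBell_zero, groverBell_1, groverBell_2, Nat.choose]
lemma groverBell_4 : groverBell 4 = 15 := by
  rw [groverBell_succ]
  norm_num [Finset.sum_range_succ, groverBell_zero, groverBell_1, groverBell_2, groverBell_3, Nat.choose]
lemma groverBell_5 : groverBell 5 = 52 := by
  rw [groverBell_succ]
  norm_num [Finset.sum_range_succ, groverBell_zero, groverBell_1, groverBell_2, groverBell_3,
    groverBell_4, Nat.choose]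
lemma groverBell_6 : groverBell 6 = 203 := by
  rw [groverBell_succ]
  norm_num [Finset.sum_range_succ, groverBell_zero, groverBell_1, groverBell_2, groverBell_3,
    groverBell_4, groverBell_5, Nat.choose]
lemma groverBell_7 : groverBell 7 = 877 := by
  rw [groverBell_succ]
  norm_num [Finset.sum_range_succ, groverBell_zero, groverBell_1, groverBell_2, groverBell_3,
    groverBell_4, groverBell_5, groverBell_6, Nat.choose]
lemma groverBell_8 : groverBell 8 = 4140 := by
  rw [groverBell_succ]
  norm_num [Finset.sum_range_succ, groverBell_zero, groverBell_1, groverBell_2, groverBell_3,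
    groverBell_4, groverBell_5, groverBell_6, groverBell_7, Nat.choose]

lemma grover_m0 : HasSum (fun t : ℕ => Real.exp (-1) / (Nat.factorial t : ℝ)) 1 := by
  have h := NormedSpace.expSeries_div_hasSum_exp (𝔸 := ℝ) 1
  rw [← Real.exp_eq_exp_ℝ] at h
  have := h.mul_left (Real.exp (-1))
  rw [← Real.exp_add] at this
  simpa [div_eq_mul_inv] using this

lemma grover_shift (k : ℕ) (h : ∀ j ≤ k, HasSum (fun t : ℕ => Real.exp (-1) / (Nat.factorial t : ℝ) * (t : ℝ) ^ j) (groverBell j)) :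
    HasSum (fun t : ℕ => Real.exp (-1) / (Nat.factorial (t + 1) : ℝ) * ((t : ℝ) + 1) ^ (k + 1)) (groverBell (k + 1)) := by
  rw [groverBell_succ]
  have := hasSum_sum (s := Finset.range (k + 1)) (fun j hj =>
    (h j (Nat.lt_succ_iff.1 (Finset.mem_range.1 hj))).mul_left (Nat.choose k j : ℝ))
  refine (congrArg (fun f => HasSum f _) (funext ?_)).mpr this
  intro t
  have e : Real.exp (-1) / (Nat.factorial (t + 1) : ℝ) * ((t : ℝ) + 1) ^ (k + 1) =
      Real.exp (-1) / (Nat.factorial t : ℝ) * ((t : ℝ) + 1) ^ k := by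
    rw [Nat.factorial_succ]
    have : (Nat.factorial t : ℝ) ≠ 0 := by positivity
    have : (t : ℝ) + 1 ≠ 0 := by positivity
    push_cast
    field_simp
    ring
  rw [e, add_pow, Finset.mul_sum]
  apply Finset.sum_congr rfl
  intro j _
  simp; ring

lemma grover_mom (k : ℕ) : HasSum (fun t : ℕ => Real.exp (-1) / (Nat.factorial t : ℝ) * (t : ℝ) ^ k) (groverBell k) := by
  induction k using Nat.strong_induction_on with
  | _ k ih =>
    cases k with
    | zero => simpa [groverBell_zero] using grover_m0
    | succ k =>
      have := grover_shift k (fun j hj => ih j (Nat.lt_succ_iff.2 hj))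
      rw [← hasSum_nat_add_iff' 1]
      simpa using this

lemma grover_mom' (k : ℕ) : HasSum (fun t : ℕ => Real.exp (-1) / (Nat.factorial (t + 1) : ℝ) * ((t : ℝ) + 1) ^ (k + 1)) (groverBell (k + 1)) :=
  grover_shift k (fun j _ => grover_mom j)

lemma grover_m1 : HasSum (fun t : ℕ => Real.exp (-1) / (Nat.factorial (t + 1) : ℝ)) (1 - Real.exp (-1)) := by
  have := (hasSum_nat_add_iff' 1).2 grover_m0
  simpa using this

lemma grover_term_nonneg (x : ℝ) (t : ℕ) : 0 ≤ Real.exp (-1) / (Nat.factorial (t + 1) : ℝ) *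
    Real.sin (2 * Real.sqrt ((t : ℝ) + 1) * x) ^ 2 := by positivity

lemma grover_term_le (x : ℝ) (t : ℕ) : Real.exp (-1) / (Nat.factorial (t + 1) : ℝ) *
    Real.sin (2 * Real.sqrt ((t : ℝ) + 1) * x) ^ 2 ≤ Real.exp (-1) / (Nat.factorial (t + 1) : ℝ) :=
  mul_le_of_le_one_right (by positivity) (Real.sin_sq_le_one _)

lemma grover_summable (x : ℝ) : Summable (fun t : ℕ => Real.exp (-1) / (Nat.factorial (t + 1) : ℝ) *
    Real.sin (2 * Real.sqrt ((t : ℝ) + 1) * x) ^ 2) :=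
  Summable.of_nonneg_of_le (grover_term_nonneg x) (grover_term_le x) grover_m1.summable

lemma grover_hasSum (x : ℝ) : HasSum (fun t : ℕ => Real.exp (-1) / (Nat.factorial (t + 1) : ℝ) *
    Real.sin (2 * Real.sqrt ((t : ℝ) + 1) * x) ^ 2) (groverKSProb x) :=
  (grover_summable x).hasSum

lemma grover_le (x : ℝ) : groverKSProb x ≤ 1 - Real.exp (-1) :=
  hasSum_le (grover_term_le x) (grover_hasSum x) grover_m1

lemma grover_pos (x : ℝ) (h0 : 0 < x) (h1 : x ≤ 1) : 0 < groverKSProb x := by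
  have h := (grover_summable x).le_tsum 0 (fun j _ => grover_term_nonneg x j)
  have hs : 0 < Real.sin (2 * x) :=
    Real.sin_pos_of_pos_of_lt_pi (by linarith) (by linarith [Real.pi_gt_three])
  refine lt_of_lt_of_le ?_ h
  have : 0 < Real.exp (-1) * Real.sin (2 * x) ^ 2 := by positivity
  simpa using this

lemma grover_cont : Continuous groverKSProb := by
  unfold groverKSProb
  apply continuous_tsum (u := fun t : ℕ => Real.exp (-1) / (Nat.factorial (t + 1) : ℝ))
  · intro t; fun_prop
  · exact grover_m1.summable
  · intro t x
    rw [Real.norm_of_nonneg (grover_term_nonneg x t)]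
    exact grover_term_le x t

lemma grover_sin_sq (x : ℝ) (T : ℝ) : Real.sin (2 * Real.sqrt T * x) ^ 2 =
    1 / 2 - Real.cos (4 * Real.sqrt T * x) / 2 := by
  rw [Real.sin_sq_eq_half_sub]; ring_nf

lemma grover_pw (x T : ℝ) (hT : 0 ≤ T) (k : ℕ) : (4 * Real.sqrt T * x) ^ (2 * k) = (16 * T * x ^ 2) ^ k := by
  rw [pow_mul]; congr 1; rw [mul_pow, mul_pow, Real.sq_sqrt hT]; norm_num

noncomputable def groverUp (x : ℝ) : ℝ := 4 * x^1 + (-32/3) * x^3 + (128/9) * x^5 + (-256/21) * x^7 + (106496/14175) * x^9 + (-237568/66825) * x^11 + (57475072/42567525) * x^13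

lemma grover_upper (x : ℝ) (hx : 0 ≤ x) : groverKSProb x ≤ x * groverUp x := by
  have hsum := (((((((grover_mom' 0).mul_left (4 * x ^ 2)).add
    ((grover_mom' 1).mul_left (-16 / 3 * x ^ 4))).add
    ((grover_mom' 2).mul_left (16 ^ 3 / (2 * 720) * x ^ 6))).add
    ((grover_mom' 3).mul_left (-16 ^ 4 / (2 * 40320) * x ^ 8))).add
    ((grover_mom' 4).mul_left (16 ^ 5 / (2 * 3628800) * x ^ 10))).add
    ((grover_mom' 5).mul_left (-16 ^ 6 / (2 * 479001600) * x ^ 12))).add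
    ((grover_mom' 6).mul_left (16 ^ 7 / (2 * 87178291200) * x ^ 14))
  have h := hasSum_le ?_ (grover_hasSum x) hsum
  · refine h.trans (le_of_eq ?_)
    norm_num only [groverBell_1, groverBell_2, groverBell_3, groverBell_4, groverBell_5, groverBell_6,
      groverBell_7]
    unfold groverUp
    ring
  · intro t
    have hT : (0 : ℝ) ≤ (t : ℝ) + 1 := by positivity
    have hc := (grover_trig 8 (4 * Real.sqrt ((t : ℝ) + 1) * x) (by positivity)).resolve_right (by norm_num)
    simp only [grover_pw x _ hT] at hc
    norm_num [Finset.sum_range_succ, Nat.factorial] at hc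
    rw [grover_sin_sq]
    have hw : 0 ≤ Real.exp (-1) / (Nat.factorial (t + 1) : ℝ) := by positivity
    have := mul_le_mul_of_nonneg_left hc hw
    generalize Real.exp (-1) / (Nat.factorial (t + 1) : ℝ) = w at *
    generalize Real.cos (4 * Real.sqrt ((t : ℝ) + 1) * x) = c at *
    ring_nf at this ⊢
    linarith

lemma grover_lower (x : ℝ) (hx : 0 ≤ x) :
    x * groverUp x + (-6029312/14189175) * x^16 ≤ groverKSProb x := by
  have hsum := ((((((((grover_mom' 0).mul_left (4 * x ^ 2)).add
    ((grover_mom' 1).mul_left (-16 / 3 * x ^ 4))).add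
    ((grover_mom' 2).mul_left (16 ^ 3 / (2 * 720) * x ^ 6))).add
    ((grover_mom' 3).mul_left (-16 ^ 4 / (2 * 40320) * x ^ 8))).add
    ((grover_mom' 4).mul_left (16 ^ 5 / (2 * 3628800) * x ^ 10))).add
    ((grover_mom' 5).mul_left (-16 ^ 6 / (2 * 479001600) * x ^ 12))).add
    ((grover_mom' 6).mul_left (16 ^ 7 / (2 * 87178291200) * x ^ 14))).add
    ((grover_mom' 7).mul_left (-16 ^ 8 / (2 * 20922789888000) * x ^ 16))
  have h := hasSum_le ?_ hsum (grover_hasSum x)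
  · refine le_trans (le_of_eq ?_) h
    norm_num only [groverBell_1, groverBell_2, groverBell_3, groverBell_4, groverBell_5, groverBell_6,
      groverBell_7, groverBell_8]
    unfold groverUp
    ring
  · intro t
    have hT : (0 : ℝ) ≤ (t : ℝ) + 1 := by positivity
    have hc := (grover_trig 9 (4 * Real.sqrt ((t : ℝ) + 1) * x) (by positivity)).resolve_right (by norm_num)
    simp only [grover_pw x _ hT] at hc
    norm_num [Finset.sum_range_succ, Nat.factorial] at hc
    rw [grover_sin_sq]
    have hw : 0 ≤ Real.exp (-1) / (Nat.factorial (t + 1) : ℝ) := by positivity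
    have := mul_le_mul_of_nonneg_left hc hw
    generalize Real.exp (-1) / (Nat.factorial (t + 1) : ℝ) = w at *
    generalize Real.cos (4 * Real.sqrt ((t : ℝ) + 1) * x) = c at *
    ring_nf at this ⊢
    linarith

lemma certA (x : ℝ) (h0 : 0 ≤ x) (h1 : x ≤ 0.43) : groverUp x < 1 / 0.9511 := by
  obtain ⟨s, hs⟩ : ∃ s : ℝ, s = (x - 0) / (43/100) := ⟨_, rfl⟩
  obtain ⟨v, hv⟩ : ∃ v : ℝ, v = 1 - s := ⟨_, rfl⟩
  have hs0 : 0 ≤ s := by rw [hs]; apply div_nonneg <;> norm_num at * <;> linarith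
  have hv0 : 0 ≤ v := by
    rw [hv, hs, sub_nonneg, div_le_one (by norm_num)]; norm_num at *; linarith
  have hx : x = 0 + (43/100) * s := by rw [hs]; ring
  have key : 1 / 0.9511 - groverUp x =
      (10000/9511) * s^0 * v^13 +
      (2841027/237775) * s^1 * v^12 +
      (14592324/237775) * s^2 * v^11 +
      (167660373577/891656250) * s^3 * v^10 +
      (34047168577/89165625) * s^4 * v^9 +
      (3609364056811127/6687421875000) * s^5 * v^8 +
      (453142226986127/835927734375) * s^6 * v^7 +
      (90632926252210176031/234059765625000000) * s^7 * v^6 +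
      (22602594480221608093/117029882812500000) * s^8 * v^5 +
      (2116891369186052307482527/32914654541015625000000) * s^9 * v^4 +
      (107076452986134763888777/8228663635253906250000) * s^10 * v^3 +
      (6919942033638167827666859231/5430917999267578125000000000) * s^11 * v^2 +
      (56682720497549415449039231/2715458999633789062500000000) * s^12 * v^1 +
      (15927545511316151666093410843/205922307472229003906250000000000) * s^13 * v^0 := by
    rw [hx, hv]; unfold groverUp; ring
  have hpos : 0 < 1 / 0.9511 - groverUp x := by
    rw [key]
    rcases hs0.eq_or_lt with h | h
    · have hv1 : v = 1 := by rw [hv, ← h]; ring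
      rw [hv1, ← h]; norm_num
    · positivity
  linarith

lemma certB (x : ℝ) (h0 : 0.44 ≤ x) (h1 : x ≤ 0.61) : groverUp x < 1 / 0.9511 := by
  obtain ⟨s, hs⟩ : ∃ s : ℝ, s = (x - 0.44) / (17/100) := ⟨_, rfl⟩
  obtain ⟨v, hv⟩ : ∃ v : ℝ, v = 1 - s := ⟨_, rfl⟩
  have hs0 : 0 ≤ s := by rw [hs]; apply div_nonneg <;> norm_num at * <;> linarith
  have hv0 : 0 ≤ v := by
    rw [hv, hs, sub_nonneg, div_le_one (by norm_num)]; norm_num at *; linarith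
  have hx : x = (11/25) + (17/100) * s := by rw [hs]; ring
  have key : 1 / 0.9511 - groverUp x =
      (3065534712397320342890156/18281454853713512420654296875) * s^0 * v^13 +
      (54964502084222751457929967/4218797273933887481689453125) * s^1 * v^12 +
      (1266622603735625603991552538/4218797273933887481689453125) * s^2 * v^11 +
      (20818707020760318286944968303/8437594547867774963378906250) * s^3 * v^10 +
      (2043981005402841010737259949/187502101063728332519531250) * s^4 * v^9 +
      (341830940418458190546442862023/11250126063823699951171875000) * s^5 * v^8 +
      (1297725103370622580996394448407/22500252127647399902343750000) * s^6 * v^7 +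
      (6971847600899079573585123894007/90001008510589599609375000000) * s^7 * v^6 +
      (3364287790835428245104131133303/45000504255294799804687500000) * s^8 * v^5 +
      (930961564159644709421056635421/18000201702117919921875000000) * s^9 * v^4 +
      (13553664192429057493459099767913/540006051063537597656250000000) * s^10 * v^3 +
      (193188618575118143450863442032439/23760266246795654296875000000000) * s^11 * v^2 +
      (4697189296169736836176190089267/2970033280849456787109375000000) * s^12 * v^1 +
      (28804899076415980081931728272781/205922307472229003906250000000000) * s^13 * v^0 := by
    rw [hx, hv]; unfold groverUp; ring
  have hpos : 0 < 1 / 0.9511 - groverUp x := by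
    rw [key]
    rcases hs0.eq_or_lt with h | h
    · have hv1 : v = 1 := by rw [hv, ← h]; ring
      rw [hv1, ← h]; norm_num
    · positivity
  linarith

lemma certC (x : ℝ) (h0 : 0.43 ≤ x) (h1 : x ≤ 0.44) : groverUp x < 1 / 0.951 := by
  obtain ⟨s, hs⟩ : ∃ s : ℝ, s = (x - 0.43) / (1/100) := ⟨_, rfl⟩
  obtain ⟨v, hv⟩ : ∃ v : ℝ, v = 1 - s := ⟨_, rfl⟩
  have hs0 : 0 ≤ s := by rw [hs]; apply div_nonneg <;> norm_num at * <;> linarith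
  have hv0 : 0 ≤ v := by
    rw [hv, hs, sub_nonneg, div_le_one (by norm_num)]; norm_num at *; linarith
  have hx : x = (43/100) + (1/100) * s := by rw [hs]; ring
  have key : 1 / 0.951 - groverUp x =
      (1289666653028125468210662521/6863355216979980468750000000000) * s^0 * v^13 +
      (392145760260372001746590713/197981400489807128906250000000) * s^1 * v^12 +
      (7657024850717870158325868571/791925601959228515625000000000) * s^2 * v^11 +
      (528551899198814160904389539/17998309135437011718750000000) * s^3 * v^10 +
      (37967558112614788048346201/599943637847900390625000000) * s^4 * v^9 +
      (157192847940274569165161911/1499859094619750976562500000) * s^5 * v^8 +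
      (419181160719140092169206043/2999718189239501953125000000) * s^6 * v^7 +
      (113882352650027078509573261/749929547309875488281250000) * s^7 * v^6 +
      (49513419406525781997612683/374964773654937744140625000) * s^8 * v^5 +
      (184299555760783216295161/2083137631416320800781250) * s^9 * v^4 +
      (12216158658299182321939027/281223580241203308105468750) * s^10 * v^3 +
      (2051300365817632952338934/140611790120601654052734375) * s^11 * v^2 +
      (418886012148004551989387/140611790120601654052734375) * s^12 * v^1 +
      (169539184340491551709132/609317757189273834228515625) * s^13 * v^0 := by
    rw [hx, hv]; unfold groverUp; ring
  have hpos : 0 < 1 / 0.951 - groverUp x := by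
    rw [key]
    rcases hs0.eq_or_lt with h | h
    · have hv1 : v = 1 := by rw [hv, ← h]; ring
      rw [hv1, ← h]; norm_num
    · positivity
  linarith

lemma grover_mid : (0.434 : ℝ) / groverKSProb 0.434 < 0.9511 := by
  have h := grover_lower 0.434 (by norm_num)
  rw [div_lt_iff₀ (grover_pos _ (by norm_num) (by norm_num))]
  refine lt_of_lt_of_le ?_ (mul_le_mul_of_nonneg_left h (by norm_num))
  unfold groverUp
  norm_num

lemma grover_of_up (x c : ℝ) (h0 : 0 < x) (h1 : x ≤ 1) (hc : 0 < c) (h : groverUp x < 1 / c) :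
    c < x / groverKSProb x := by
  rw [lt_div_iff₀ (grover_pos x h0 h1)]
  have h2 := grover_upper x h0.le
  rw [lt_div_iff₀ hc] at h
  calc c * groverKSProb x ≤ c * (x * groverUp x) := mul_le_mul_of_nonneg_left h2 hc.le
    _ = x * (groverUp x * c) := by ring
    _ < x * 1 := mul_lt_mul_of_pos_left h h0
    _ = x := mul_one x

lemma grover_outside (x : ℝ) (h0 : 0 < x) (h1 : x ≤ 1) (h : x ≤ 0.43 ∨ 0.44 ≤ x) :
    0.9511 < x / groverKSProb x := by
  rcases h with h | h
  · exact grover_of_up x _ h0 h1 (by norm_num) (certA x h0.le h)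
  · rcases le_total x 0.61 with h2 | h2
    · exact grover_of_up x _ h0 h1 (by norm_num) (certB x h h2)
    · rw [lt_div_iff₀ (grover_pos x h0 h1)]
      have := grover_le x
      have := Real.exp_neg_one_gt_d9
      norm_num at *
      linarith

/-- Proposition 1: `x / P(x)` attains its minimum on `(0, 1]` at some `x* ∈ (0.43, 0.44)`, with
minimum value in `(0.951, 0.952)`; i.e. the optimal expected number of Grover iterations for
key search of a random function is `0.951… · √N`, attained at `0.434… · √N` iterations. -/
theorem key_search_expected_iteration_constant :
    ∃ xs ∈ Set.Ioc (0 : ℝ) 1,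
      (∀ x ∈ Set.Ioc (0 : ℝ) 1, xs / groverKSProb xs ≤ x / groverKSProb x) ∧
      xs ∈ Set.Ioo (0.43 : ℝ) 0.44 ∧
      xs / groverKSProb xs ∈ Set.Ioo (0.951 : ℝ) 0.952 := by
  have hcont : ContinuousOn (fun x : ℝ => x / groverKSProb x) (Set.Icc 0.43 0.44) := by
    apply continuousOn_id.div grover_cont.continuousOn
    intro x hx
    have h1 := hx.1
    have h2 := hx.2
    exact (grover_pos x (by norm_num at *; linarith) (by norm_num at *; linarith)).ne'
  obtain ⟨xs, hxs, hmin⟩ := isCompact_Icc.exists_isMinOn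
    (Set.nonempty_Icc.2 (by norm_num : (0.43 : ℝ) ≤ 0.44)) hcont
  have hmid : xs / groverKSProb xs ≤ 0.434 / groverKSProb 0.434 :=
    hmin (show (0.434 : ℝ) ∈ Set.Icc (0.43 : ℝ) 0.44 by constructor <;> norm_num)
  have hlt := hmid.trans_lt grover_mid
  have h0 : 0 < xs := lt_of_lt_of_le (by norm_num) hxs.1
  have h1 : xs ≤ 1 := hxs.2.trans (by norm_num)
  have hin : xs ∈ Set.Ioo (0.43 : ℝ) 0.44 := by
    constructor
    · by_contra! hc
      exact absurd hlt (grover_outside xs h0 h1 (Or.inl hc)).not_gt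
    · by_contra! hc
      exact absurd hlt (grover_outside xs h0 h1 (Or.inr hc)).not_gt
  refine ⟨xs, ⟨h0, h1⟩, ?_, hin, ?_, hlt.trans (by norm_num)⟩
  · intro x hx
    by_cases h : x ≤ 0.43 ∨ 0.44 ≤ x
    · exact (hlt.trans (grover_outside x hx.1 hx.2 h)).le
    · push Not at h
      exact hmin (show x ∈ Set.Icc (0.43 : ℝ) 0.44 from ⟨h.1.le, h.2.le⟩)
  · exact grover_of_up xs _ h0 h1 (by norm_num) (certC xs hxs.1 hxs.2)
end

section
/- The function x ↦ x/(1 − e^(−4x²)) on (0, ∞) attains a global minimum; the minimum is attained at the unique x > 0 satisfying e^(4x²) = 1 + 8x², and the minimum value lies in the open interval (0.783, 0.785). (This is the constant in the outer-parallelization expected iteration count I_rand^(KS:OP) = 0.784…·√(N/S_q) for key search on S_q machines.) -/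
lemma aux_chord {a b : ℝ} (ha : 0 < a) (hab : a < b) :
    b * (Real.exp a - 1) < a * (Real.exp b - 1) := by
  have h := strictConvexOn_exp.secant_strict_mono (a := 0) (x := a) (y := b)
    (Set.mem_univ _) (Set.mem_univ _) (Set.mem_univ _) ha.ne' (ha.trans hab).ne' hab
  simp only [Real.exp_zero, sub_zero] at h
  rw [div_lt_div_iff₀ ha (ha.trans hab)] at h
  linarith

lemma aux_deriv (x : ℝ) (hx : 0 < x) :
    HasDerivAt (fun x : ℝ => x / (1 - Real.exp (-4 * x ^ 2)))
      (Real.exp (-4 * x ^ 2) * (Real.exp (4 * x ^ 2) - (1 + 8 * x ^ 2)) /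
        (1 - Real.exp (-4 * x ^ 2)) ^ 2) x := by
  have hne : 1 - Real.exp (-4 * x ^ 2) ≠ 0 := by
    have : Real.exp (-4 * x ^ 2) < 1 := by rw [Real.exp_lt_one_iff]; nlinarith [pow_pos hx 2]
    linarith
  have h1 : HasDerivAt (fun x : ℝ => -4 * x ^ 2) (-4 * (2 * x)) x := by
    simpa using (hasDerivAt_pow 2 x).const_mul (-4)
  have h := (hasDerivAt_id x).div (h1.exp.const_sub 1) hne
  refine h.congr_deriv ?_
  have he : Real.exp (-4 * x ^ 2) * Real.exp (4 * x ^ 2) = 1 := by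
    rw [← Real.exp_add]; simp
  congr 1
  simp only [id]
  linear_combination -he

/-- The function `x ↦ x / (1 - e^(-4x²))` on `(0, ∞)` attains a global minimum, exactly at the
unique `x > 0` with `e^(4x²) = 1 + 8x²`, and the minimum value lies in `(0.783, 0.785)`. -/
theorem outer_parallelization_constant :
    ∃ x₀ : ℝ, 0 < x₀ ∧
      (∀ x : ℝ, 0 < x →
        x₀ / (1 - Real.exp (-4 * x₀ ^ 2)) ≤ x / (1 - Real.exp (-4 * x ^ 2))) ∧
      Real.exp (4 * x₀ ^ 2) = 1 + 8 * x₀ ^ 2 ∧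
      (∀ x : ℝ, 0 < x → Real.exp (4 * x ^ 2) = 1 + 8 * x ^ 2 → x = x₀) ∧
      x₀ / (1 - Real.exp (-4 * x₀ ^ 2)) ∈ Set.Ioo (0.783 : ℝ) 0.785 := by
  have hlo : Real.exp (4 * (0.5597:ℝ) ^ 2) - (1 + 8 * (0.5597:ℝ) ^ 2) ≤ 0 := by
    have h1 := Real.exp_one_lt_d9
    have h2 := Real.exp_bound' (x := 4 * (0.5597:ℝ) ^ 2 - 1) (by norm_num) (by norm_num)
      (n := 5) (by norm_num)
    have h3 : Real.exp (4 * (0.5597:ℝ) ^ 2) =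
        Real.exp 1 * Real.exp (4 * (0.5597:ℝ) ^ 2 - 1) := by
      rw [← Real.exp_add]; ring_nf
    rw [h3]
    have h4 : Real.exp (4 * (0.5597:ℝ) ^ 2 - 1) ≤ 1.289 := by
      refine h2.trans ?_
      norm_num [Finset.sum_range_succ, Nat.factorial]
    have := mul_le_mul h1.le h4 (Real.exp_pos _).le (by norm_num)
    norm_num at this ⊢
    linarith
  have hhi : 0 ≤ Real.exp (4 * (0.5615:ℝ) ^ 2) - (1 + 8 * (0.5615:ℝ) ^ 2) := by
    have h2 := Real.sum_le_exp_of_nonneg (x := 4 * (0.5615:ℝ) ^ 2) (by norm_num) 9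
    norm_num [Finset.sum_range_succ, Nat.factorial] at h2 ⊢
    linarith
  have hc : ContinuousOn (fun x : ℝ => Real.exp (4 * x ^ 2) - (1 + 8 * x ^ 2))
      (Set.Icc 0.5597 0.5615) := by fun_prop
  obtain ⟨x₀, ⟨hl, hr⟩, h0⟩ := intermediate_value_Icc (by norm_num) hc ⟨hlo, hhi⟩
  have h0 : Real.exp (4 * x₀ ^ 2) = 1 + 8 * x₀ ^ 2 := by
    simp only at h0; linarith
  have hp : 0 < x₀ := lt_of_lt_of_le (by norm_num) hl
  have hlt : ∀ x, 0 < x → x < x₀ → Real.exp (4 * x ^ 2) < 1 + 8 * x ^ 2 := by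
    intro x hx hxx
    have h := aux_chord (a := 4 * x ^ 2) (b := 4 * x₀ ^ 2) (by positivity) (by gcongr)
    rw [h0] at h
    have : 0 < 4 * x₀ ^ 2 := by positivity
    by_contra! hcon
    nlinarith
  have hgt : ∀ x, x₀ < x → 1 + 8 * x ^ 2 < Real.exp (4 * x ^ 2) := by
    intro x hxx
    have h := aux_chord (a := 4 * x₀ ^ 2) (b := 4 * x ^ 2) (by positivity) (by gcongr)
    rw [h0] at h
    have : 0 < 4 * x₀ ^ 2 := by positivity
    by_contra! hcon
    nlinarith
  have hval : x₀ / (1 - Real.exp (-4 * x₀ ^ 2)) = x₀ + 1 / (8 * x₀) := by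
    have : Real.exp (-4 * x₀ ^ 2) = (1 + 8 * x₀ ^ 2)⁻¹ := by
      rw [← h0, ← Real.exp_neg]; ring_nf
    rw [this]
    have h8 : (1 + 8 * x₀ ^ 2) ≠ 0 := by positivity
    have h9 : 1 - (1 + 8 * x₀ ^ 2)⁻¹ = 8 * x₀ ^ 2 / (1 + 8 * x₀ ^ 2) := by
      field_simp; ring
    rw [h9]
    field_simp
    ring
  refine ⟨x₀, hp, ?_, h0, ?_, ?_⟩
  · intro x hx
    rcases le_total x x₀ with h | h
    · have : AntitoneOn (fun x : ℝ => x / (1 - Real.exp (-4 * x ^ 2))) (Set.Ioc 0 x₀) := by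
        refine antitoneOn_of_hasDerivWithinAt_nonpos (convex_Ioc _ _)
          (fun y hy => (aux_deriv y hy.1).continuousAt.continuousWithinAt)
          (fun y hy => (aux_deriv y (interior_subset hy).1).hasDerivWithinAt) ?_
        intro y hy
        rw [interior_Ioc] at hy
        refine div_nonpos_of_nonpos_of_nonneg (mul_nonpos_of_nonneg_of_nonpos
          (Real.exp_pos _).le ?_) (sq_nonneg _)
        linarith [hlt y hy.1 hy.2]
      exact this ⟨hx, h⟩ ⟨hp, le_rfl⟩ h
    · have : MonotoneOn (fun x : ℝ => x / (1 - Real.exp (-4 * x ^ 2))) (Set.Ici x₀) := by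
        refine monotoneOn_of_hasDerivWithinAt_nonneg (convex_Ici _)
          (fun y hy => (aux_deriv y (hp.trans_le hy)).continuousAt.continuousWithinAt)
          (fun y hy => (aux_deriv y (hp.trans_le (interior_subset hy))).hasDerivWithinAt) ?_
        intro y hy
        rw [interior_Ici] at hy
        refine div_nonneg (mul_nonneg (Real.exp_pos _).le ?_) (sq_nonneg _)
        linarith [hgt y hy]
      exact this (Set.mem_Ici.2 le_rfl) h h
  · intro x hx he
    rcases lt_trichotomy x x₀ with h | h | h
    · exact absurd he (hlt x hx h).ne
    · exact h
    · exact absurd he (hgt x h).ne'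
  · rw [hval]
    have : x₀ + 1 / (8 * x₀) = (8 * x₀ ^ 2 + 1) / (8 * x₀) := by field_simp
    rw [this]
    norm_num at hl hr
    constructor
    · rw [lt_div_iff₀ (by positivity)]; norm_num; nlinarith
    · rw [div_lt_iff₀ (by positivity)]; norm_num; nlinarith
end

section
/- The function z ↦ z/(2·(1 − e^(cos²z − 1))) on the interval (0, π) attains a global minimum, and the minimum value lies in the open interval (0.980, 0.982). (This is the constant in the inner-parallelization expected iteration count for pre-image search, I_rand^(PS:IP) = 0.981…·√(N/S_q).) -/
lemma pip_cos (z : ℝ) : Real.cos z ^ 2 - 1 = -1/2 - Real.sin (2 * z - Real.pi / 2) / 2 := by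
  rw [Real.sin_sub_pi_div_two, Real.cos_sq]; ring

lemma pip_half : (0.6065 : ℝ) < Real.exp (-1/2) ∧ Real.exp (-1/2) < 0.60654 := by
  have h : Real.exp (-1/2) * Real.exp (-1/2) * Real.exp 1 = 1 := by
    rw [← Real.exp_add, ← Real.exp_add]; norm_num
  have h1 := Real.exp_one_lt_d9
  have h2 := Real.exp_one_gt_d9
  have hp := Real.exp_pos (-1/2)
  constructor
  · by_contra hc
    have hc := not_lt.mp hc
    have : Real.exp (-1/2) * Real.exp (-1/2) ≤ 0.6065 * 0.6065 := by gcongr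
    nlinarith
  · by_contra hc
    have hc := not_lt.mp hc
    have : (0.60654:ℝ) * 0.60654 ≤ Real.exp (-1/2) * Real.exp (-1/2) := by gcongr
    nlinarith

lemma pip_exp (x : ℝ) (hx : |x| ≤ 1) :
    |Real.exp x - (1 + x + x ^ 2 / 2 + x ^ 3 / 6)| ≤ |x| ^ 4 * (5 / 96) := by
  have h := Real.exp_bound hx (n := 4) (by norm_num)
  norm_num [Finset.sum_range_succ, Nat.factorial] at h
  exact h

lemma pip_arcsin (y : ℝ) (hy : 0 ≤ y) : Real.sin y + Real.sin y ^ 3 / 6 ≤ y := by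
  have hd : ∀ x : ℝ, HasDerivAt (fun x => x - (Real.sin x + Real.sin x ^ 3 / 6))
      (1 - (Real.cos x + (3 * Real.sin x ^ 2 * Real.cos x) / 6)) x := by
    intro x
    have h := Real.hasDerivAt_sin x
    have := (hasDerivAt_id x).sub (h.add ((h.pow 3).div_const 6))
    norm_num at this
    exact this
  have hm : Monotone (fun x : ℝ => x - (Real.sin x + Real.sin x ^ 3 / 6)) := by
    apply monotone_of_deriv_nonneg
    · exact fun x => (hd x).differentiableAt
    · intro x
      rw [(hd x).deriv]
      have h1 := Real.sin_sq_add_cos_sq x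
      have h2 := Real.neg_one_le_cos x
      have h3 : Real.sin x ^ 2 = 1 - Real.cos x ^ 2 := by linarith
      rw [h3]
      have : 0 ≤ (Real.cos x - 1) ^ 2 * (Real.cos x + 2) := mul_nonneg (sq_nonneg _) (by linarith)
      nlinarith
  have := hm hy
  simp at this
  linarith

lemma pip_pos (z : ℝ) (hz : z ∈ Set.Ioo (0 : ℝ) Real.pi) :
    0 < 2 * (1 - Real.exp (Real.cos z ^ 2 - 1)) := by
  have hs := Real.sin_pos_of_mem_Ioo hz
  have h1 := Real.sin_sq_add_cos_sq z
  have : Real.exp (Real.cos z ^ 2 - 1) < 1 := by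
    rw [Real.exp_lt_one_iff]; nlinarith [pow_pos hs 2]
  linarith

lemma pip_big (z : ℝ) : 0.3678 < Real.exp (Real.cos z ^ 2 - 1) := by
  have h : Real.exp (-1) ≤ Real.exp (Real.cos z ^ 2 - 1) := by
    apply Real.exp_le_exp.mpr; nlinarith [sq_nonneg (Real.cos z)]
  have := Real.exp_neg_one_gt_d9
  linarith

lemma pip_small (z : ℝ) : 1 - z ^ 2 ≤ Real.exp (Real.cos z ^ 2 - 1) := by
  have h := Real.add_one_le_exp (Real.cos z ^ 2 - 1)
  have h1 := Real.sin_sq_add_cos_sq z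
  have h2 : Real.sin z ^ 2 ≤ z ^ 2 := sq_le_sq.mpr Real.abs_sin_le_abs
  linarith

lemma pip_low (z : ℝ) (hz : z ∈ Set.Ioo (0 : ℝ) Real.pi) :
    1.96 * (1 - Real.exp (Real.cos z ^ 2 - 1)) < z := by
  obtain ⟨h0, h1⟩ := hz
  have hp1 := Real.pi_gt_d6
  have hp2 := Real.pi_lt_d6
  obtain ⟨he1, he2⟩ := pip_half
  rcases le_or_gt z 0.5 with h | h
  · have := pip_small z
    nlinarith
  rcases le_or_gt 1.3 z with h' | h'
  · have := pip_big z
    linarith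
  obtain ⟨y, hy⟩ : ∃ y, y = 2 * z - Real.pi / 2 := ⟨_, rfl⟩
  have hsp : Real.exp (Real.cos z ^ 2 - 1) = Real.exp (-1/2) * Real.exp (-Real.sin y / 2) := by
    rw [pip_cos, ← hy, ← Real.exp_add]; congr 1; ring
  rw [hsp]
  rcases le_or_gt 0 y with hy0 | hy0
  · have ha := pip_arcsin y hy0
    have hv1 := Real.sin_le_one y
    have hv0 : 0 ≤ Real.sin y := Real.sin_nonneg_of_nonneg_of_le_pi hy0 (by linarith)
    generalize Real.sin y = v at *
    have hb := pip_exp (-v / 2) (by rw [abs_le]; constructor <;> linarith)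
    rw [show |-v / 2| = v / 2 by rw [abs_of_nonpos (by linarith)]; ring] at hb
    have hb := (abs_le.mp hb).1
    have hE : 1 - v / 2 + v ^ 2 / 8 - v ^ 3 / 48 - v ^ 4 * (5 / 1536) ≤ Real.exp (-v / 2) := by
      nlinarith
    have hE2 : 0.6065 * (1 - v / 2 + v ^ 2 / 8 - v ^ 3 / 48 - v ^ 3 * (5 / 1536)) ≤
        Real.exp (-1/2) * Real.exp (-v / 2) := by
      have h4 : v ^ 4 ≤ v ^ 3 := by nlinarith [pow_nonneg hv0 3]
      have := Real.exp_pos (-v / 2)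
      nlinarith
    have hQ : 0 < 1.96 * (0.6065 * (1 - v / 2 + v ^ 2 / 8 - v ^ 3 / 48 - v ^ 3 * (5 / 1536))) - 1.96 +
        (0.785398 + (v + v ^ 3 / 6) / 2) := by
      nlinarith [mul_nonneg hv0 (sq_nonneg (v - 0.28)), sq_nonneg (v - 0.28)]
    have hzy : 0.785398 + (v + v ^ 3 / 6) / 2 ≤ z := by linarith
    generalize Real.exp (-1/2) * Real.exp (-v / 2) = E at *
    linarith
  · have hx := Real.sin_gt_sub_cube (x := -y) (by linarith)
    rw [Real.sin_neg] at hx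
    have hv : Real.sin y < 0 := Real.sin_neg_of_neg_of_neg_pi_lt hy0 (by linarith)
    have hyv : 1.1 * Real.sin y ≤ y := by
      have : (-y) ^ 3 ≤ (-y) * 0.35 := by
        have : (-y)^2 ≤ 0.35 := by nlinarith
        nlinarith
      linarith
    have h6 := Real.add_one_le_exp (-Real.sin y / 2)
    have : 0.6065 * (-Real.sin y / 2 + 1) ≤ Real.exp (-1/2) * Real.exp (-Real.sin y / 2) := by
      gcongr
      linarith
    linarith

lemma pip_up : ∃ z ∈ Set.Icc (0.4 : ℝ) 2,
    z < 1.964 * (1 - Real.exp (Real.cos z ^ 2 - 1)) := by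
  have hp1 := Real.pi_gt_d6
  have hp2 := Real.pi_lt_d6
  obtain ⟨he1, he2⟩ := pip_half
  refine ⟨Real.pi / 4 + 0.135, ⟨by linarith, by linarith⟩, ?_⟩
  rw [pip_cos, show 2 * (Real.pi / 4 + 0.135) - Real.pi / 2 = 0.27 by ring]
  have hs : (0.2664 : ℝ) ≤ Real.sin 0.27 := by
    have := (abs_le.mp (Real.sin_bound (x := 0.27) (by norm_num [abs_le]))).1
    norm_num [abs_of_pos] at this ⊢
    linarith
  have h1 : Real.exp (-1/2 - Real.sin 0.27 / 2) ≤ Real.exp (-1/2) * Real.exp (-0.1332) := by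
    rw [← Real.exp_add]; apply Real.exp_le_exp.mpr; linarith
  have h2 : Real.exp (-0.1332) ≤ 0.87532 := by
    have := (abs_le.mp (pip_exp (-0.1332) (by norm_num [abs_le]))).2
    norm_num [abs_of_pos] at this ⊢
    linarith
  have h3 : Real.exp (-1/2) * Real.exp (-0.1332) ≤ 0.60654 * 0.87532 := by gcongr
  linarith

/-- The function `z ↦ z / (2(1 - e^(cos²z - 1)))` attains a global minimum on `(0, π)`, with
minimum value in `(0.980, 0.982)` (inner parallelization of pre-image search). -/
theorem preimage_inner_parallelization_constant :
    ∃ z₀ ∈ Set.Ioo (0 : ℝ) Real.pi,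
      (∀ z ∈ Set.Ioo (0 : ℝ) Real.pi,
        z₀ / (2 * (1 - Real.exp (Real.cos z₀ ^ 2 - 1))) ≤
          z / (2 * (1 - Real.exp (Real.cos z ^ 2 - 1)))) ∧
      z₀ / (2 * (1 - Real.exp (Real.cos z₀ ^ 2 - 1))) ∈ Set.Ioo (0.980 : ℝ) 0.982 := by
  have hp1 := Real.pi_gt_d6
  have hsub : ∀ z ∈ Set.Icc (0.4 : ℝ) 2, z ∈ Set.Ioo (0 : ℝ) Real.pi :=
    fun z hz => ⟨by linarith [hz.1], by linarith [hz.2]⟩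
  obtain ⟨z₁, hz₁, hu⟩ := pip_up
  have hc : ContinuousOn (fun z : ℝ => z / (2 * (1 - Real.exp (Real.cos z ^ 2 - 1))))
      (Set.Icc (0.4 : ℝ) 2) := by
    apply ContinuousOn.div
    · fun_prop
    · fun_prop
    · intro z hz
      exact (pip_pos z (hsub z hz)).ne'
  obtain ⟨z₀, hz₀, hmin⟩ := isCompact_Icc.exists_isMinOn ⟨z₁, hz₁⟩ hc
  have hlt : z₀ / (2 * (1 - Real.exp (Real.cos z₀ ^ 2 - 1))) < 0.982 := by
    refine lt_of_le_of_lt (hmin hz₁) ?_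
    show z₁ / (2 * (1 - Real.exp (Real.cos z₁ ^ 2 - 1))) < 0.982
    rw [div_lt_iff₀ (pip_pos z₁ (hsub z₁ hz₁))]
    linarith
  refine ⟨z₀, hsub z₀ hz₀, ?_, ?_, hlt⟩
  · intro z hz
    by_cases hzz : z ∈ Set.Icc (0.4 : ℝ) 2
    · exact hmin hzz
    · refine hlt.le.trans ?_
      rw [le_div_iff₀ (pip_pos z hz)]
      rcases lt_or_ge z 0.4 with h | h
      · have := pip_small z
        nlinarith [hz.1]
      · have h2 : 2 < z := by
          by_contra h3
          exact hzz ⟨h, not_lt.mp h3⟩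
        have := pip_big z
        linarith
  · rw [lt_div_iff₀ (pip_pos z₀ (hsub z₀ hz₀))]
    have := pip_low z₀ (hsub z₀ hz₀)
    linarith
end

section
/- The function z ↦ z/(1 − e^(−2·sin⁴z)) on the interval (0, π) attains a global minimum, and the minimum value lies in the open interval (1.531, 1.533). (Proposition 5: this is the constant in the GwDP trade-offs curve T_q^GwDP · S_q^GwDP = 1.532…·N^(1/2).) -/
lemma gw_d1 (x : ℝ) : HasDerivAt (fun z : ℝ => Real.sin z ^ 4) (4 * Real.sin x ^ 3 * Real.cos x) x := by
  have := (Real.hasDerivAt_sin x).pow 4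
  norm_num at this
  exact this

lemma gw_d2 (x : ℝ) : HasDerivAt (fun z : ℝ => 4 * Real.sin z ^ 3 * Real.cos z)
    (4 * Real.sin x ^ 2 * (4 * Real.cos x ^ 2 - 1)) x := by
  have := (((Real.hasDerivAt_sin x).pow 3).const_mul 4).mul (Real.hasDerivAt_cos x)
  have h := Real.sin_sq_add_cos_sq x
  refine HasDerivAt.congr_deriv this ?_
  simp only [Pi.pow_apply]
  push_cast
  linear_combination (-4 * Real.sin x ^ 2) * h

lemma gw_convex : ConvexOn ℝ (Set.Icc 0 (Real.pi / 3)) (fun z : ℝ => Real.sin z ^ 4) := by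
  refine convexOn_of_hasDerivWithinAt2_nonneg (convex_Icc _ _) (by fun_prop)
    (fun x _ => (gw_d1 x).hasDerivWithinAt) (fun x _ => (gw_d2 x).hasDerivWithinAt) ?_
  intro x hx
  rw [interior_Icc] at hx
  have h : Real.cos (Real.pi / 3) ≤ Real.cos x :=
    Real.cos_le_cos_of_nonneg_of_le_pi hx.1.le (by linarith [Real.pi_pos]) hx.2.le
  rw [Real.cos_pi_div_three] at h
  have : 0 ≤ 4 * Real.cos x ^ 2 - 1 := by nlinarith
  positivity

lemma gw_concave : ConcaveOn ℝ (Set.Icc (Real.pi / 3) (Real.pi / 2))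
    (fun z : ℝ => Real.sin z ^ 4) := by
  refine concaveOn_of_hasDerivWithinAt2_nonpos (convex_Icc _ _) (by fun_prop)
    (fun x _ => (gw_d1 x).hasDerivWithinAt) (fun x _ => (gw_d2 x).hasDerivWithinAt) ?_
  intro x hx
  rw [interior_Icc] at hx
  have hp := Real.pi_pos
  have h : Real.cos x ≤ Real.cos (Real.pi / 3) :=
    Real.cos_le_cos_of_nonneg_of_le_pi (by linarith) (by linarith [hx.2]) hx.1.le
  rw [Real.cos_pi_div_three] at h
  have h0 : 0 ≤ Real.cos x := Real.cos_nonneg_of_mem_Icc ⟨by linarith [hx.1], hx.2.le⟩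
  have : 4 * Real.cos x ^ 2 - 1 ≤ 0 := by nlinarith
  exact mul_nonpos_of_nonneg_of_nonpos (by positivity) this

lemma gw_tangent (u u0 : ℝ) : Real.exp (-u0) * (1 + u0 - u) ≤ Real.exp (-u) := by
  have h := Real.add_one_le_exp (u0 - u)
  have : Real.exp (-u) = Real.exp (-u0) * Real.exp (u0 - u) := by
    rw [← Real.exp_add]; congr 1; ring
  rw [this]
  exact mul_le_mul_of_nonneg_left (by linarith) (Real.exp_pos _).le

lemma gw_e135 : 0.25923 < Real.exp (-1.35) := by
  have h1 := Real.exp_neg_one_gt_d9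
  have h2 : Real.exp (0.35 : ℝ) ≤ _ :=
    Real.exp_bound' (x := 0.35) (by norm_num) (by norm_num) (n := 7) (by norm_num)
  norm_num [Finset.sum_range_succ, Nat.factorial] at h2
  have h3 : Real.exp (-1.35) * Real.exp 0.35 = Real.exp (-1) := by
    rw [← Real.exp_add]; norm_num
  have h4 := Real.exp_pos (-1.35)
  norm_num at h1 h2 h3 h4 ⊢
  nlinarith

lemma gw_e1349 : Real.exp (-1.349) < 0.25951 := by
  have h1 := Real.exp_neg_one_lt_d9
  have h2 := Real.sum_le_exp_of_nonneg (x := 0.349) (by norm_num) 7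
  norm_num [Finset.sum_range_succ, Nat.factorial] at h2
  have h3 : Real.exp (-1.349) * Real.exp 0.349 = Real.exp (-1) := by
    rw [← Real.exp_add]; norm_num
  have h4 := Real.exp_pos (-1.349)
  norm_num at h1 h2 h3 h4 ⊢
  nlinarith

lemma gw_e2 : 0.1353 < Real.exp (-2) := by
  have h1 := Real.exp_neg_one_gt_d9
  have : Real.exp (-2) = Real.exp (-1) * Real.exp (-1) := by rw [← Real.exp_add]; norm_num
  rw [this]; norm_num at h1 ⊢; nlinarith

lemma gw_sc : (0.9063 < Real.sin (Real.pi / 3 + 0.0873) ∧ Real.sin (Real.pi / 3 + 0.0873) < 0.90634)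
    ∧ (0.4225 < Real.cos (Real.pi / 3 + 0.0873) ∧ Real.cos (Real.pi / 3 + 0.0873) < 0.4227) := by
  rw [Real.sin_add, Real.cos_add, Real.sin_pi_div_three, Real.cos_pi_div_three]
  have hs := Real.sin_bound (x := 0.0873) (by norm_num [abs_le])
  have hc := Real.cos_bound (x := 0.0873) (by norm_num [abs_le])
  rw [abs_of_pos (show (0:ℝ) < 0.0873 by norm_num), abs_le] at hs hc
  have r1 : 1.73205 < √3 := by apply Real.lt_sqrt_of_sq_lt; norm_num
  have r2 : √3 < 1.73206 := by rw [Real.sqrt_lt' (by norm_num)]; norm_num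
  obtain ⟨hs1, hs2⟩ := hs
  obtain ⟨hc1, hc2⟩ := hc
  have a1 : 0.08718 < Real.sin 0.0873 := by norm_num at *; linarith
  have a2 : Real.sin 0.0873 < 0.0872 := by norm_num at *; linarith
  have b1 : 0.996186 < Real.cos 0.0873 := by norm_num at *; linarith
  have b2 : Real.cos 0.0873 < 0.996193 := by norm_num at *; linarith
  refine ⟨⟨?_, ?_⟩, ?_, ?_⟩ <;> nlinarith

lemma gw_pos {z : ℝ} (hz : z ∈ Set.Ioo (0:ℝ) Real.pi) :
    0 < 1 - Real.exp (-2 * Real.sin z ^ 4) := by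
  have := Real.sin_pos_of_mem_Ioo hz
  have h4 : 0 < Real.sin z ^ 4 := by positivity
  have : Real.exp (-2 * Real.sin z ^ 4) < 1 := by
    rw [Real.exp_lt_one_iff]; linarith
  linarith

lemma gw_small {z : ℝ} (h0 : 0 < z) (h1 : z ≤ 1 / 2) :
    1.533 * (1 - Real.exp (-2 * Real.sin z ^ 4)) < z := by
  have h := Real.add_one_le_exp (-2 * Real.sin z ^ 4)
  have hs : 0 ≤ Real.sin z :=
    (Real.sin_pos_of_pos_of_lt_pi h0 (by linarith [Real.pi_gt_three])).le
  have h4 : Real.sin z ^ 4 ≤ z ^ 4 := pow_le_pow_left₀ hs (Real.sin_le h0.le) 4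
  have h3 : z ^ 3 ≤ (1 / 2) ^ 3 := pow_le_pow_left₀ h0.le h1 3
  have h5 : z ^ 4 ≤ (1 / 8) * z := by nlinarith
  linarith

lemma gw_large {z : ℝ} (h1 : 1.33 ≤ z) :
    1.531 * (1 - Real.exp (-2 * Real.sin z ^ 4)) < z ∧
    (1.4 ≤ z → 1.533 * (1 - Real.exp (-2 * Real.sin z ^ 4)) < z) := by
  have h : Real.exp (-2) ≤ Real.exp (-2 * Real.sin z ^ 4) := by
    rw [Real.exp_le_exp]
    have : Real.sin z ^ 4 ≤ 1 := by
      have := Real.sin_sq_le_one z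
      nlinarith [sq_nonneg (Real.sin z)]
    linarith
  have := h.trans_lt' gw_e2
  clear h
  norm_num at *
  constructor
  · linarith
  · intro; linarith

lemma gw_mid1 {z : ℝ} (h0 : 1 / 2 ≤ z) (h1 : z ≤ Real.pi / 3) :
    1.531 * (1 - Real.exp (-2 * Real.sin z ^ 4)) < z := by
  have hp := Real.pi_gt_d4
  have hp2 := Real.pi_lt_d4
  have hconv : ConvexOn ℝ (Set.Icc 0 (Real.pi / 3))
      ((fun z : ℝ => Real.sin z ^ 4) + fun z : ℝ => (-0.888) * z) := by
    refine gw_convex.add ⟨convex_Icc _ _, ?_⟩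
    intro x _ y _ a b _ _ _
    simp only [smul_eq_mul]
    apply le_of_eq; ring
  have hm := hconv.le_max_of_mem_Icc (x := 1 / 2) (y := Real.pi / 3) (z := z)
    ⟨by norm_num, by linarith⟩ ⟨by positivity, le_rfl⟩ ⟨h0, h1⟩
  simp only [Pi.add_apply] at hm
  have e1 : Real.sin (1 / 2) ^ 4 ≤ (1 / 2 : ℝ) ^ 4 := by
    apply pow_le_pow_left₀ _ (Real.sin_le (by norm_num)) 4
    exact (Real.sin_pos_of_pos_of_lt_pi (by norm_num) (by linarith)).le
  have e2 : Real.sin (Real.pi / 3) ^ 4 = 9 / 16 := by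
    rw [Real.sin_pi_div_three]
    have : (√3) ^ 2 = 3 := Real.sq_sqrt (by norm_num)
    rw [show (√3 / 2) ^ 4 = (√3 ^ 2) ^ 2 / 16 by ring, this]; norm_num
  rw [e2] at hm
  have hm2 : Real.sin z ^ 4 + -0.888 * z ≤ -0.3615 := by
    refine hm.trans (max_le ?_ ?_)
    · norm_num at *; linarith
    · norm_num at *; linarith
  have ht := gw_tangent (2 * Real.sin z ^ 4) 1
  have he := Real.exp_neg_one_gt_d9
  rw [show -(2 * Real.sin z ^ 4) = -2 * Real.sin z ^ 4 by ring] at ht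
  have hs1 : Real.sin z ^ 4 ≤ 1 := by
    have := Real.sin_sq_le_one z
    nlinarith [sq_nonneg (Real.sin z)]
  have : 0.36787 * (1 + 1 - 2 * Real.sin z ^ 4) ≤ Real.exp (-2 * Real.sin z ^ 4) := by
    refine le_trans (mul_le_mul_of_nonneg_right ?_ (by linarith)) ht
    norm_num at *; linarith
  norm_num at *
  linarith

lemma gw_mid2 {z : ℝ} (h0 : Real.pi / 3 ≤ z) (h1 : z ≤ 1.33) :
    1.531 * (1 - Real.exp (-2 * Real.sin z ^ 4)) < z := by
  have hp := Real.pi_gt_d4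
  have hp2 := Real.pi_lt_d4
  obtain ⟨⟨s1, s2⟩, c1, c2⟩ := gw_sc
  obtain ⟨z0, hz0⟩ : ∃ z0, z0 = Real.pi / 3 + 0.0873 := ⟨_, rfl⟩
  rw [← hz0] at s1 s2 c1 c2
  have q4 : Real.sin z0 ^ 4 < 0.90634 ^ 4 := pow_lt_pow_left₀ s2 (by linarith) (by norm_num)
  have q3 : Real.sin z0 ^ 3 < 0.90634 ^ 3 := pow_lt_pow_left₀ s2 (by linarith) (by norm_num)
  have q3' : 0.9063 ^ 3 < Real.sin z0 ^ 3 := pow_lt_pow_left₀ s1 (by norm_num) (by norm_num)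
  have qa : 4 * Real.sin z0 ^ 3 * Real.cos z0 < 1.2589 := by
    norm_num at *; nlinarith
  have qb : 1.258 < 4 * Real.sin z0 ^ 3 * Real.cos z0 := by
    norm_num at *; nlinarith
  have hd := gw_d1 z0
  obtain ⟨q, hq⟩ : ∃ q, q = 4 * Real.sin z0 ^ 3 * Real.cos z0 := ⟨_, rfl⟩
  rw [← hq] at qa qb hd
  have m0 : z0 ∈ Set.Icc (Real.pi / 3) (Real.pi / 2) := by
    constructor <;> norm_num at * <;> linarith
  have m1 : z ∈ Set.Icc (Real.pi / 3) (Real.pi / 2) := by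
    constructor <;> norm_num at * <;> linarith
  have hT : Real.sin z ^ 4 ≤ Real.sin z0 ^ 4 + q * (z - z0) := by
    rcases lt_trichotomy z z0 with h | h | h
    · have := gw_concave.le_slope_of_hasDerivAt m1 m0 h hd
      rw [slope_def_field, le_div_iff₀ (by linarith)] at this
      linarith
    · rw [h]; simp
    · have := gw_concave.slope_le_of_hasDerivAt m0 m1 h hd
      rw [slope_def_field, div_le_iff₀ (by linarith)] at this
      linarith
  have ht := gw_tangent (2 * Real.sin z ^ 4) 1.35
  have he := gw_e135
  rw [show -(2 * Real.sin z ^ 4) = -2 * Real.sin z ^ 4 by ring] at ht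
  have hs1 : Real.sin z ^ 4 ≤ 1 := by
    have := Real.sin_sq_le_one z
    nlinarith [sq_nonneg (Real.sin z)]
  have key : 0.25923 * (1 + 1.35 - 2 * Real.sin z ^ 4) ≤ Real.exp (-2 * Real.sin z ^ 4) := by
    refine le_trans (mul_le_mul_of_nonneg_right he.le ?_) ht
    norm_num; linarith
  rcases le_total z z0 with h | h
  · have : q * (z - z0) ≤ 1.258 * (z - z0) := by nlinarith
    norm_num at *; linarith
  · have : q * (z - z0) ≤ 1.2589 * (z - z0) := by nlinarith
    norm_num at *; linarith

lemma gw_lower {z : ℝ} (h0 : 0 < z) :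
    1.531 * (1 - Real.exp (-2 * Real.sin z ^ 4)) < z := by
  rcases le_total z (1 / 2) with h | h
  · have h1 := gw_small h0 h
    have : Real.exp (-2 * Real.sin z ^ 4) ≤ 1 := by
      rw [Real.exp_le_one_iff]
      have : 0 ≤ Real.sin z ^ 4 := by positivity
      linarith
    norm_num at *; linarith
  rcases le_total z (Real.pi / 3) with h' | h'
  · exact gw_mid1 h h'
  rcases le_total z 1.33 with h2 | h2
  · exact gw_mid2 h' h2
  · exact (gw_large h2).1

/-- The function `z ↦ z / (1 - e^(-2 sin⁴ z))` attains a global minimum on `(0, π)`, with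
minimum value in `(1.531, 1.533)` (constant of the GwDP trade-offs curve). -/
theorem gwdp_constant :
    ∃ z₀ ∈ Set.Ioo (0 : ℝ) Real.pi,
      (∀ z ∈ Set.Ioo (0 : ℝ) Real.pi,
        z₀ / (1 - Real.exp (-2 * Real.sin z₀ ^ 4)) ≤
          z / (1 - Real.exp (-2 * Real.sin z ^ 4))) ∧
      z₀ / (1 - Real.exp (-2 * Real.sin z₀ ^ 4)) ∈ Set.Ioo (1.531 : ℝ) 1.533 := by
  have hp := Real.pi_gt_d4
  have hp2 := Real.pi_lt_d4
  have hsub : ∀ z ∈ Set.Icc (1 / 2 : ℝ) 1.4, z ∈ Set.Ioo (0:ℝ) Real.pi := by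
    rintro z ⟨h1, h2⟩
    constructor <;> norm_num at * <;> linarith
  have hcont : ContinuousOn (fun z : ℝ => z / (1 - Real.exp (-2 * Real.sin z ^ 4)))
      (Set.Icc (1 / 2 : ℝ) 1.4) := by
    apply ContinuousOn.div (by fun_prop) (by fun_prop)
    intro z hz
    exact (gw_pos (hsub z hz)).ne'
  obtain ⟨z₀, hz₀, hmin⟩ := isCompact_Icc.exists_isMinOn
    (Set.nonempty_Icc.2 (by norm_num)) hcont
  have hmin' := isMinOn_iff.1 hmin
  have hz1 : Real.pi / 3 + 0.0873 ∈ Set.Icc (1 / 2 : ℝ) 1.4 := by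
    constructor <;> norm_num at * <;> linarith
  have hup : z₀ / (1 - Real.exp (-2 * Real.sin z₀ ^ 4)) < 1.533 := by
    refine (hmin' _ hz1).trans_lt ?_
    show _ / _ < _
    rw [div_lt_iff₀ (gw_pos (hsub _ hz1))]
    have h4 : 0.9063 ^ 4 < Real.sin (Real.pi / 3 + 0.0873) ^ 4 :=
      pow_lt_pow_left₀ gw_sc.1.1 (by norm_num) (by norm_num)
    have : Real.exp (-2 * Real.sin (Real.pi / 3 + 0.0873) ^ 4) ≤ Real.exp (-1.349) := by
      rw [Real.exp_le_exp]; norm_num at *; linarith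
    replace this := this.trans_lt gw_e1349
    norm_num at *; linarith
  refine ⟨z₀, hsub _ hz₀, ?_, ?_, hup⟩
  · intro z hz
    by_cases h : z ∈ Set.Icc (1 / 2 : ℝ) 1.4
    · exact hmin' z h
    · refine hup.le.trans ?_
      rw [le_div_iff₀ (gw_pos hz)]
      rcases le_total z (1 / 2) with h1 | h1
      · exact (gw_small hz.1 h1).le
      · have h2 : 1.4 ≤ z := by
          by_contra hc
          exact h ⟨h1, (not_le.1 hc).le⟩
        exact ((gw_large (by norm_num at *; linarith)).2 h2).le
  · rw [lt_div_iff₀ (gw_pos (hsub _ hz₀))]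
    exact gw_lower (hsub _ hz₀).1
end

section
/- Let t > 0 and n be real numbers, and set d = (2/5)·(n + log₂(8t³/π)) and l = d/2 + log₂(π/(2t)). Then 2^(l + d/2) + 2^((n − d − l)/2)·((π/2)·2^(d/2) + t·2^l) = 2^(6/5)·π^(3/5)·t^(1/5)·2^(2n/5), and moreover the two summands on the left-hand side are equal. (Proposition 6: with these parameters the expected iteration count of the CNS collision finding algorithm equals I_rand^CNS = 0.690…·2^(6/5)π^(3/5)·t_L^(1/5)·2^(2n/5) = 3.150…·t_L^(1/5)·2^(2n/5).) -/
open Real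

/-- Proposition 6: with the optimal parameters `d, l`, the expected iteration count of the CNS
collision finding algorithm evaluates to `2^(6/5) π^(3/5) t^(1/5) 2^(2n/5)` (in units of
`0.690… ` Grover iterations), and the two summands are balanced. -/
theorem cns_optimal_parameters (t n : ℝ) (ht : 0 < t) (d l : ℝ)
    (hd : d = (2 / 5) * (n + Real.logb 2 (8 * t ^ 3 / π)))
    (hl : l = d / 2 + Real.logb 2 (π / (2 * t))) :
    (2 : ℝ) ^ (l + d / 2) +
        (2 : ℝ) ^ ((n - d - l) / 2) * ((π / 2) * (2 : ℝ) ^ (d / 2) + t * (2 : ℝ) ^ l) =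
      (2 : ℝ) ^ ((6 : ℝ) / 5) * π ^ ((3 : ℝ) / 5) * t ^ ((1 : ℝ) / 5) *
        (2 : ℝ) ^ (2 * n / 5) ∧
    (2 : ℝ) ^ (l + d / 2) =
      (2 : ℝ) ^ ((n - d - l) / 2) * ((π / 2) * (2 : ℝ) ^ (d / 2) + t * (2 : ℝ) ^ l) := by
  have hpi : 0 < π := Real.pi_pos
  generalize π = q at *
  obtain ⟨p, rfl⟩ : ∃ p : ℝ, q = (2 : ℝ) ^ p :=
    ⟨Real.logb 2 q, (Real.rpow_logb (by norm_num) (by norm_num) hpi).symm⟩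
  obtain ⟨s, rfl⟩ : ∃ s : ℝ, t = (2 : ℝ) ^ s :=
    ⟨Real.logb 2 t, (Real.rpow_logb (by norm_num) (by norm_num) ht).symm⟩
  have h2 : (0 : ℝ) < 2 := by norm_num
  have e1 : (8 : ℝ) * ((2 : ℝ) ^ s) ^ 3 / (2 : ℝ) ^ p = (2 : ℝ) ^ (3 + 3 * s - p) := by
    rw [Real.rpow_sub h2, Real.rpow_add h2, mul_comm 3 s, Real.rpow_mul h2.le]
    norm_num
  have e2 : (2 : ℝ) ^ p / (2 * (2 : ℝ) ^ s) = (2 : ℝ) ^ (p - (1 + s)) := by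
    rw [Real.rpow_sub h2, Real.rpow_add h2, Real.rpow_one]
  rw [e1, Real.logb_rpow h2 (by norm_num)] at hd
  rw [e2, Real.logb_rpow h2 (by norm_num)] at hl
  have a1 : (2 : ℝ) ^ p / 2 * (2 : ℝ) ^ (d / 2) = (2 : ℝ) ^ (p - 1 + d / 2) := by
    rw [Real.rpow_add h2, Real.rpow_sub h2, Real.rpow_one]
  have a2 : (2 : ℝ) ^ s * (2 : ℝ) ^ l = (2 : ℝ) ^ (p - 1 + d / 2) := by
    rw [← Real.rpow_add h2]
    congr 1
    rw [hl]; ring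
  have a3 : (2 : ℝ) ^ (p - 1 + d / 2) + (2 : ℝ) ^ (p - 1 + d / 2) = (2 : ℝ) ^ (p + d / 2) := by
    have : p + d / 2 = (p - 1 + d / 2) + 1 := by ring
    rw [this, Real.rpow_add h2 _ 1, Real.rpow_one]; ring
  have b : (2 : ℝ) ^ (l + d / 2) = (2 : ℝ) ^ ((n - d - l) / 2) *
      ((2 : ℝ) ^ p / 2 * (2 : ℝ) ^ (d / 2) + (2 : ℝ) ^ s * (2 : ℝ) ^ l) := by
    rw [a1, a2, a3, ← Real.rpow_add h2]
    congr 1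
    rw [hl, hd]; ring
  refine ⟨?_, b⟩
  rw [← b, ← Real.rpow_mul h2.le, ← Real.rpow_mul h2.le, ← Real.rpow_add h2,
    ← Real.rpow_add h2, ← Real.rpow_add h2]
  have : 6 / 5 + p * (3 / 5) + s * (1 / 5) + 2 * n / 5 = (l + d / 2) + 1 := by
    rw [hl, hd]; ring
  rw [this, Real.rpow_add h2 _ 1, Real.rpow_one]; ring
end

section
/- Let κ₁, κ₂, t > 0 and n, s be real numbers, set d = (2/5)·(n + s + log₂((κ₂/κ₁)²·8t³/π)) and l = d/2 + log₂(π/(2t)), and let T = κ₁·2^(l + d/2 − s) + κ₂·2^((n − d − l − s)/2)·((π/2)·2^(d/2) + t·2^l) and S = 2^s. Then T^5 · S^3 = κ₁·κ₂^4·64·π³·t·2^(2n). (Proposition 7: the parallelization trade-offs curve of the CNS collision finding algorithm is (T_q^CNS)^5·(S_q^CNS)^3 = (3.488…)^5·t_L·N², since (κ₁^(1/5)κ₂^(4/5)·2^(6/5)π^(3/5))^5 = κ₁κ₂⁴·64π³.) -/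
open Real

/-- Proposition 7: the parallelization trade-offs curve of the CNS collision finding algorithm,
`T⁵ S³ = κ₁ κ₂⁴ · 64 π³ · t · N²` with `N = 2^n`, `S = 2^s`. -/
theorem cns_tradeoffs_curve (κ₁ κ₂ t n s : ℝ)
    (hκ₁ : 0 < κ₁) (hκ₂ : 0 < κ₂) (ht : 0 < t) (d l T S : ℝ)
    (hd : d = (2 / 5) * (n + s + Real.logb 2 ((κ₂ / κ₁) ^ 2 * 8 * t ^ 3 / π)))
    (hl : l = d / 2 + Real.logb 2 (π / (2 * t)))
    (hT : T = κ₁ * (2 : ℝ) ^ (l + d / 2 - s) +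
        κ₂ * (2 : ℝ) ^ ((n - d - l - s) / 2) *
          ((π / 2) * (2 : ℝ) ^ (d / 2) + t * (2 : ℝ) ^ l))
    (hS : S = (2 : ℝ) ^ s) :
    T ^ 5 * S ^ 3 = κ₁ * κ₂ ^ 4 * 64 * π ^ 3 * t * (2 : ℝ) ^ (2 * n) := by
  have hπ := Real.pi_pos
  have h2 : (0 : ℝ) < 2 := by norm_num
  have hA : 0 < (κ₂ / κ₁) ^ 2 * 8 * t ^ 3 / π := by positivity
  have hB : 0 < π / (2 * t) := by positivity
  have eA : (2 : ℝ) ^ (Real.logb 2 ((κ₂ / κ₁) ^ 2 * 8 * t ^ 3 / π))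
      = (κ₂ / κ₁) ^ 2 * 8 * t ^ 3 / π := Real.rpow_logb h2 (by norm_num) hA
  have eB : (2 : ℝ) ^ (Real.logb 2 (π / (2 * t))) = π / (2 * t) :=
    Real.rpow_logb h2 (by norm_num) hB
  obtain ⟨D, hD⟩ : ∃ D, D = (2 : ℝ) ^ (d / 2) := ⟨_, rfl⟩
  obtain ⟨N, hN⟩ : ∃ N, N = (2 : ℝ) ^ n := ⟨_, rfl⟩
  obtain ⟨E, hE⟩ : ∃ E, E = (2 : ℝ) ^ ((n - d - l - s) / 2) := ⟨_, rfl⟩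
  have pD : 0 < D := hD ▸ Real.rpow_pos_of_pos h2 _
  have pN : 0 < N := hN ▸ Real.rpow_pos_of_pos h2 _
  have pE : 0 < E := hE ▸ Real.rpow_pos_of_pos h2 _
  have pS : 0 < S := hS ▸ Real.rpow_pos_of_pos h2 _
  have eL : (2 : ℝ) ^ l = D * (π / (2 * t)) := by
    rw [hl, Real.rpow_add h2, eB, hD]
  have e1 : (2 : ℝ) ^ (l + d / 2 - s) = D * (π / (2 * t)) * D / S := by
    rw [Real.rpow_sub h2, Real.rpow_add h2, eL, ← hD, ← hS]
  have eD5 : D ^ 5 = N * S * ((κ₂ / κ₁) ^ 2 * 8 * t ^ 3 / π) := by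
    rw [← eA, hN, hS, hD, ← Real.rpow_add h2, ← Real.rpow_add h2, ← Real.rpow_mul_natCast h2.le]
    congr 1
    rw [hd]; push_cast; ring
  have eE2 : E ^ 2 * (D ^ 2 * (D * (π / (2 * t))) * S) = N := by
    rw [← eL, hN, hS, hD, hE, ← Real.rpow_mul_natCast h2.le, ← Real.rpow_mul_natCast h2.le,
      ← Real.rpow_add h2, ← Real.rpow_add h2, ← Real.rpow_add h2]
    congr 1
    push_cast; ring
  have eN2 : (2 : ℝ) ^ (2 * n) = N ^ 2 := by
    rw [hN, ← Real.rpow_mul_natCast h2.le]; congr 1; push_cast; ring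
  have key : κ₂ * E * (2 * t * S) = κ₁ * D := by
    have hsq : (κ₂ * E * (2 * t * S)) ^ 2 = (κ₁ * D) ^ 2 := by
      have h := eD5
      rw [← eE2] at h
      field_simp at h
      linear_combination -h / 2
    exact (pow_left_inj₀ (by positivity) (by positivity) two_ne_zero).1 hsq
  have hE' : κ₂ * E = κ₁ * D / (2 * t * S) := by
    field_simp; linear_combination key
  have hT' : T = κ₁ * π * D ^ 2 / (t * S) := by
    rw [hT, e1, eL, ← hE, ← hD, hE']
    field_simp; ring
  have h10 : D ^ 10 = (N * S * ((κ₂ / κ₁) ^ 2 * 8 * t ^ 3 / π)) ^ 2 := by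
    rw [← eD5]; ring
  rw [eN2, hT']
  have : (κ₁ * π * D ^ 2 / (t * S)) ^ 5 * S ^ 3 = κ₁ ^ 5 * π ^ 5 * D ^ 10 / (t ^ 5 * S ^ 2) := by
    field_simp
  rw [this, h10]
  field_simp
  norm_num
end

section
/- Let κ be the minimum of the function z ↦ z/(2·sin²z) over the interval (0, π). Then 0.476 < κ² < 0.477; consequently, for any real N > 0 and S > 0, if T = κ·√(N/S) then T²·S = κ²·N and in particular 0.476·N < T²·S < 0.477·N. (Proposition 2: for S_q^KS ≫ 1, the parallelization trade-offs of Grover's algorithm for key search of a random function is (T_q^KS)²·S_q^KS = 0.476…·N.) -/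
lemma ksAux (f g : ℝ → ℝ) (h : ∀ x, HasDerivAt f (g x) x) (h0 : f 0 = 0)
    (hg : ∀ x, 0 ≤ x → 0 ≤ g x) : ∀ x, 0 ≤ x → 0 ≤ f x := by
  intro x hx
  have hm : MonotoneOn f (Set.Ici 0) := by
    apply monotoneOn_of_deriv_nonneg (convex_Ici 0)
    · exact fun y _ => (h y).continuousAt.continuousWithinAt
    · exact fun y _ => (h y).differentiableAt.differentiableWithinAt
    · intro y hy
      rw [interior_Ici] at hy
      rw [(h y).deriv]
      exact hg y (le_of_lt hy)
  have := hm (Set.mem_Ici.2 le_rfl) (Set.mem_Ici.2 hx) hx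
  rwa [h0] at this

/-- cosine Taylor polynomial -/
noncomputable def ksC (n : ℕ) (x : ℝ) : ℝ :=
  ∑ i ∈ Finset.range n, (-1) ^ i * x ^ (2 * i) / (2 * i).factorial
/-- sine Taylor polynomial -/
noncomputable def ksS (n : ℕ) (x : ℝ) : ℝ :=
  ∑ i ∈ Finset.range n, (-1) ^ i * x ^ (2 * i + 1) / (2 * i + 1).factorial

lemma ksS_deriv (n : ℕ) (x : ℝ) : HasDerivAt (ksS n) (ksC n x) x := by
  unfold ksS ksC
  apply HasDerivAt.fun_sum
  intro i _
  have := (((hasDerivAt_pow (2 * i + 1) x).const_mul ((-1 : ℝ) ^ i)).div_const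
    ((2 * i + 1).factorial : ℝ))
  refine this.congr_deriv ?_
  rw [Nat.factorial_succ]
  have : ((2 * i).factorial : ℝ) ≠ 0 := by positivity
  push_cast
  have h2 : (2 * (i : ℝ) + 1) ≠ 0 := by positivity
  field_simp

lemma ksC_deriv (n : ℕ) (x : ℝ) : HasDerivAt (ksC (n + 1)) (-ksS n x) x := by
  unfold ksS ksC
  simp only [Finset.sum_range_succ' _ n]
  rw [← Finset.sum_neg_distrib]
  simp only [Nat.mul_zero, pow_zero, Nat.factorial_zero]
  apply HasDerivAt.add_const
  apply HasDerivAt.fun_sum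
  intro i _
  have := (((hasDerivAt_pow (2 * (i + 1)) x).const_mul ((-1 : ℝ) ^ (i + 1))).div_const
    ((2 * (i + 1)).factorial : ℝ))
  refine this.congr_deriv ?_
  have e : 2 * (i + 1) = (2 * i + 1) + 1 := by ring
  rw [e, Nat.factorial_succ (2 * i + 1)]
  have : ((2 * i + 1).factorial : ℝ) ≠ 0 := by positivity
  push_cast
  have h2 : (2 * (i : ℝ) + 1 + 1) ≠ 0 := by positivity
  field_simp
  ring

lemma ksC_zero (n : ℕ) : ksC (n + 1) 0 = 1 := by
  unfold ksC
  rw [Finset.sum_range_succ']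
  simp

lemma ksS_zero (n : ℕ) : ksS n 0 = 0 := by
  unfold ksS
  simp

lemma ks_main (n : ℕ) : ∀ x : ℝ, 0 ≤ x → 0 ≤ (-1) ^ n * (Real.cos x - ksC (n + 1) x) * (-1) := by
  have step : ∀ n : ℕ, (∀ x : ℝ, 0 ≤ x → 0 ≤ (-1) ^ n * (Real.cos x - ksC (n + 1) x) * (-1)) →
      ∀ x : ℝ, 0 ≤ x → 0 ≤ (-1) ^ n * (Real.sin x - ksS (n + 1) x) * (-1) := by
    intro n h
    refine ksAux _ _ (fun x => ?_) ?_ h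
    · exact ((((Real.hasDerivAt_sin x).sub (ksS_deriv (n + 1) x)).const_mul _).mul_const _)
    · simp [ksS_zero]
  induction n with
  | zero =>
    intro x _
    have := Real.cos_le_one x
    simp [ksC]
    linarith
  | succ n ih =>
    refine ksAux _ _ (fun x => ?_) ?_ (step n ih)
    · refine ((((Real.hasDerivAt_cos x).sub (ksC_deriv (n + 1) x)).const_mul
        ((-1 : ℝ) ^ (n + 1))).mul_const (-1)).congr_deriv ?_
      ring
    · simp [ksC_zero]

lemma ks_sin (n : ℕ) : ∀ x : ℝ, 0 ≤ x → 0 ≤ (-1) ^ n * (Real.sin x - ksS (n + 1) x) * (-1) := by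
  refine ksAux _ _ (fun x => ?_) ?_ (ks_main n)
  · exact ((((Real.hasDerivAt_sin x).sub (ksS_deriv (n + 1) x)).const_mul _).mul_const _)
  · simp [ksS_zero]

lemma ks_num : (-0.68914 : ℝ) < Real.cos 2.331 ∧ Real.cos 2.331 < -0.6890 ∧
    0.7245 < Real.sin 2.331 ∧ Real.sin 2.331 < 0.7248 := by
  have h1 := ks_main 7 2.331 (by norm_num)
  have h2 := ks_main 6 2.331 (by norm_num)
  have h3 := ks_sin 7 2.331 (by norm_num)
  have h4 := ks_sin 6 2.331 (by norm_num)
  simp only [ksC, ksS, Finset.sum_range_succ, Finset.sum_range_zero, Nat.factorial] at h1 h2 h3 h4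
  norm_num at h1 h2 h3 h4
  norm_num
  refine ⟨?_, ?_, ?_, ?_⟩ <;> linarith

lemma ks_low (w : ℝ) (hw : 0 < w) : 0.68993 * (1 - Real.cos w) < w / 2 := by
  rcases lt_or_ge w 1.44 with h | h
  · have := Real.one_sub_sq_div_two_le_cos (x := w)
    nlinarith
  rcases lt_or_ge 2.77 w with h' | h'
  · have := Real.neg_one_le_cos w
    linarith
  obtain ⟨c1, c2, s1, s2⟩ := ks_num
  have hc : ∀ t : ℝ, 0 ≤ t → Real.cos t ≤ 1 - t ^ 2 / 2 + t ^ 4 / 24 := by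
    intro t ht
    have := ks_main 2 t ht
    simp [ksC, Finset.sum_range_succ, Nat.factorial] at this
    linarith
  have hs : ∀ t : ℝ, 0 ≤ t → t - t ^ 3 / 6 ≤ Real.sin t := by
    intro t ht
    have := ks_sin 1 t ht
    simp [ksS, Finset.sum_range_succ, Nat.factorial] at this
    linarith
  rcases le_total 2.331 w with h2 | h2
  · obtain ⟨t, rfl⟩ : ∃ t, w = 2.331 + t := ⟨w - 2.331, by ring⟩
    have ht : 0 ≤ t := by linarith
    have ht2 : t ≤ 0.44 := by linarith
    have a1 := hc t ht
    have a2 := Real.sin_le ht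
    rw [Real.cos_add]
    have b3 : t ^ 4 ≤ t ^ 2 := pow_le_pow_of_le_one ht (by linarith) (by norm_num)
    have b1 : Real.cos 2.331 * Real.cos t ≥
        -0.68914 + 0.6890 * (t ^ 2 / 2 - t ^ 4 / 24) := by
      have : 0 ≤ t ^ 2 / 2 - t ^ 4 / 24 := by linarith [sq_nonneg t]
      nlinarith
    have b2 : Real.sin 2.331 * Real.sin t ≤ 0.7248 * t := by nlinarith
    nlinarith [sq_nonneg (t - 0.0001)]
  · obtain ⟨t, rfl⟩ : ∃ t, w = 2.331 - t := ⟨2.331 - w, by ring⟩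
    have ht : 0 ≤ t := by linarith
    have ht2 : t ≤ 0.9 := by linarith
    have a1 := hc t ht
    have a2 := hs t ht
    rw [Real.cos_sub]
    have b3 : t ^ 4 ≤ t ^ 2 := pow_le_pow_of_le_one ht (by linarith) (by norm_num)
    have b1 : Real.cos 2.331 * Real.cos t ≥
        -0.68914 + 0.6890 * (t ^ 2 / 2 - t ^ 4 / 24) := by
      have : 0 ≤ t ^ 2 / 2 - t ^ 4 / 24 := by linarith [sq_nonneg t]
      nlinarith
    have b0 : 0 ≤ t - t ^ 3 / 6 := by nlinarith [mul_nonneg ht ht]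
    have b2 : Real.sin 2.331 * Real.sin t ≥ 0.7245 * (t - t ^ 3 / 6) := by nlinarith
    have b4 : t ^ 3 ≤ 0.9 * t ^ 2 := by nlinarith [sq_nonneg t]
    nlinarith [sq_nonneg (t - 0.001)]

/-- Proposition 2 (KS trade-offs curve): with `κ` the minimum of `z / (2 sin² z)` on `(0, π)`,
one has `0.476 < κ² < 0.477`, and for `T = κ √(N/S)` the trade-off `T² S = κ² N` holds, hence
`0.476 N < T² S < 0.477 N`. -/
theorem key_search_tradeoffs_curve (κ : ℝ)
    (hκ : IsLeast ((fun z : ℝ => z / (2 * Real.sin z ^ 2)) '' Set.Ioo 0 Real.pi) κ) :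
    0.476 < κ ^ 2 ∧ κ ^ 2 < 0.477 ∧
    ∀ N S : ℝ, 0 < N → 0 < S → ∀ T : ℝ, T = κ * Real.sqrt (N / S) →
      T ^ 2 * S = κ ^ 2 * N ∧ 0.476 * N < T ^ 2 * S ∧ T ^ 2 * S < 0.477 * N := by
  obtain ⟨⟨z, ⟨hz0, hz1⟩, hz⟩, hmin⟩ := hκ
  have key : ∀ z : ℝ, 2 * Real.sin z ^ 2 = 1 - Real.cos (2 * z) := by
    intro z
    rw [Real.cos_two_mul, Real.cos_sq']
    ring
  have hlow : 0.68993 < κ := by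
    have hs := Real.sin_pos_of_pos_of_lt_pi hz0 hz1
    have := ks_low (2 * z) (by linarith)
    rw [← hz]
    simp only
    rw [lt_div_iff₀ (by positivity), key]
    linarith
  have hup : κ < 0.6903 := by
    have hp := Real.pi_gt_three
    have hs : 0 < Real.sin 1.1655 :=
      Real.sin_pos_of_pos_of_lt_pi (by norm_num) (by linarith)
    have := hmin ⟨1.1655, ⟨by norm_num, by linarith⟩, rfl⟩
    refine lt_of_le_of_lt this ?_
    simp only
    rw [div_lt_iff₀ (by positivity), key]
    have e : (2 : ℝ) * 1.1655 = 2.331 := by norm_num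
    rw [e]
    have := ks_num.2.1
    linarith
  have k1 : 0.476 < κ ^ 2 := by nlinarith
  have k2 : κ ^ 2 < 0.477 := by nlinarith
  refine ⟨k1, k2, ?_⟩
  intro N S hN hS T hT
  have hE : T ^ 2 * S = κ ^ 2 * N := by
    rw [hT, mul_pow, Real.sq_sqrt (by positivity)]
    field_simp
  refine ⟨hE, ?_, ?_⟩
  · rw [hE]; exact mul_lt_mul_of_pos_right k1 hN
  · rw [hE]; exact mul_lt_mul_of_pos_right k2 hN
end

section
/- Let μ be the minimum of the function x ↦ x/(1 − e^(−4x²)) over (0, ∞). Then 0.613 < μ² < 0.616; consequently, for any real N > 0 and S > 0, if T = μ·√(N/S) then T²·S = μ²·N and in particular 0.613·N < T²·S < 0.616·N. (Proposition 4: for S_q^PS ≫ 1, the parallelization trade-offs of Grover's algorithm for pre-image search of a random function is (T_q^PS)²·S_q^PS = 0.614…·N.) -/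
lemma cubic_le_exp_aux (u : ℝ) : 1 + u + u ^ 2 / 2 + u ^ 3 / 6 ≤ Real.exp u := by
  have hd : ∀ v : ℝ, HasDerivAt (fun u : ℝ => (1 + u + u ^ 2 / 2 + u ^ 3 / 6) * Real.exp (-u))
      (-(v ^ 3 / 6) * Real.exp (-v)) v := by
    intro v
    have h1 : HasDerivAt (fun u : ℝ => 1 + u + u ^ 2 / 2 + u ^ 3 / 6) (1 + v + v ^ 2 / 2) v := by
      have := (((hasDerivAt_id v).const_add 1).add (((hasDerivAt_id v).pow 2).div_const 2)).add
        (((hasDerivAt_id v).pow 3).div_const 6)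
      refine this.congr_deriv ?_
      simp
      ring
    have h2 : HasDerivAt (fun u : ℝ => Real.exp (-u)) (Real.exp (-v) * (-1)) v :=
      (hasDerivAt_neg v).exp
    refine (h1.mul h2).congr_deriv ?_
    ring
  have key : (1 + u + u ^ 2 / 2 + u ^ 3 / 6) * Real.exp (-u) ≤ 1 := by
    have hc : Continuous (fun u : ℝ => (1 + u + u ^ 2 / 2 + u ^ 3 / 6) * Real.exp (-u)) := by
      fun_prop
    rcases le_total 0 u with h | h
    · have := antitoneOn_of_deriv_nonpos (convex_Ici (0 : ℝ)) hc.continuousOn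
        (fun x _ => (hd x).differentiableAt.differentiableWithinAt) (fun x hx => by
          rw [(hd x).deriv]
          rw [interior_Ici] at hx
          have hx0 : (0 : ℝ) < x := hx
          have : 0 ≤ x ^ 3 / 6 * Real.exp (-x) := by positivity
          linarith) (Set.mem_Ici.2 le_rfl) (Set.mem_Ici.2 h) h
      simpa using this
    · have := monotoneOn_of_deriv_nonneg (convex_Iic (0 : ℝ)) hc.continuousOn
        (fun x _ => (hd x).differentiableAt.differentiableWithinAt) (fun x hx => by
          rw [(hd x).deriv]
          rw [interior_Iic] at hx
          have hx0 : x < 0 := hx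
          have h3 : 0 ≤ -(x ^ 3 / 6) := by
            have : 0 ≤ (-x) ^ 3 := pow_nonneg (by linarith) 3
            nlinarith
          exact mul_nonneg h3 (Real.exp_pos _).le) (Set.mem_Iic.2 h) (Set.mem_Iic.2 le_rfl) h
      simpa using this
  rw [Real.exp_neg, ← div_eq_mul_inv, div_le_one (Real.exp_pos u)] at key
  exact key

lemma exp_pow_aux : Real.exp (-(5 / 4)) ^ 4 * Real.exp 1 ^ 5 = 1 := by
  rw [← Real.exp_nat_mul, ← Real.exp_nat_mul, ← Real.exp_add]
  norm_num

lemma exp_lower_aux : (0.2865 : ℝ) ≤ Real.exp (-(5 / 4)) := by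
  by_contra! h
  have h1 : Real.exp (-(5 / 4)) ^ 4 ≤ 0.2865 ^ 4 :=
    pow_le_pow_left₀ (Real.exp_pos _).le h.le 4
  have h2 : Real.exp 1 ^ 5 ≤ 2.7182818286 ^ 5 :=
    pow_le_pow_left₀ (Real.exp_pos _).le Real.exp_one_lt_d9.le 5
  have h3 := mul_le_mul h1 h2 (by positivity) (by positivity)
  rw [exp_pow_aux] at h3
  norm_num at h3

lemma exp_upper_aux : Real.exp (-(5 / 4)) ≤ (0.28651 : ℝ) := by
  by_contra! h
  have h1 : (0.28651 : ℝ) ^ 4 ≤ Real.exp (-(5 / 4)) ^ 4 :=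
    pow_le_pow_left₀ (by norm_num) h.le 4
  have h2 : (2.7182818283 : ℝ) ^ 5 ≤ Real.exp 1 ^ 5 :=
    pow_le_pow_left₀ (by norm_num) Real.exp_one_gt_d9.le 5
  have h3 := mul_le_mul h1 h2 (by positivity) (by positivity)
  rw [exp_pow_aux] at h3
  norm_num at h3

lemma lower_aux (x : ℝ) (hx : 0 < x) : 1 - Real.exp (-4 * x ^ 2) < x / 0.78295 := by
  have he := Real.exp_pos (-4 * x ^ 2)
  rcases le_or_gt 0.78295 x with h | h
  · have : 1 ≤ x / 0.78295 := by rw [le_div_iff₀ (by norm_num)]; linarith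
    linarith
  rcases lt_or_ge x 0.3 with h' | h'
  · have h1 := Real.add_one_le_exp (-4 * x ^ 2)
    have h2 : 4 * x ^ 2 < x / 0.78295 := by
      rw [lt_div_iff₀ (by norm_num)]
      nlinarith
    linarith
  have hE : 0.2865 * (1 + (5 / 4 - 4 * x ^ 2) + (5 / 4 - 4 * x ^ 2) ^ 2 / 2
      + (5 / 4 - 4 * x ^ 2) ^ 3 / 6) ≤ Real.exp (-4 * x ^ 2) := by
    have e : Real.exp (-4 * x ^ 2) = Real.exp (-(5 / 4)) * Real.exp (5 / 4 - 4 * x ^ 2) := by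
      rw [← Real.exp_add]; congr 1; ring
    rw [e]
    exact (mul_le_mul_of_nonneg_left (cubic_le_exp_aux _) (by norm_num)).trans
      (mul_le_mul_of_nonneg_right exp_lower_aux (Real.exp_pos _).le)
  have hQ : 0 ≤ -0.1248178888 + 3.629110016 * x + 2.2819152 * x ^ 2 - 3.42272 * x ^ 3
      - 3.056 * x ^ 4 := by
    have a2 : x ^ 2 ≤ 0.79 * x := by nlinarith
    have a3 : x ^ 3 ≤ 0.79 * x ^ 2 := by nlinarith [sq_nonneg x]
    have a4 : x ^ 4 ≤ 0.79 * x ^ 3 := by nlinarith [pow_pos hx 3]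
    linarith
  have hm := mul_nonneg (sq_nonneg (x - 0.56)) hQ
  have hx2 : x / 0.78295 = (100000 / 78295) * x := by ring
  rw [hx2]
  nlinarith

/-- Proposition 4 (PS trade-offs curve): with `μ` the minimum of `x / (1 - e^(-4x²))` on
`(0, ∞)`, one has `0.613 < μ² < 0.616`, and for `T = μ √(N/S)` the trade-off `T² S = μ² N`
holds, hence `0.613 N < T² S < 0.616 N`. -/
theorem preimage_search_tradeoffs_curve (μ : ℝ)
    (hμ : IsLeast ((fun x : ℝ => x / (1 - Real.exp (-4 * x ^ 2))) '' Set.Ioi 0) μ) :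
    0.613 < μ ^ 2 ∧ μ ^ 2 < 0.616 ∧
    ∀ N S : ℝ, 0 < N → 0 < S → ∀ T : ℝ, T = μ * Real.sqrt (N / S) →
      T ^ 2 * S = μ ^ 2 * N ∧ 0.613 * N < T ^ 2 * S ∧ T ^ 2 * S < 0.616 * N := by
  obtain ⟨⟨x, hx, hxμ⟩, hlb⟩ := hμ
  have hx0 : 0 < x := hx
  have hden : ∀ y : ℝ, 0 < y → 0 < 1 - Real.exp (-4 * y ^ 2) := by
    intro y hy
    have : Real.exp (-4 * y ^ 2) < 1 := Real.exp_lt_one_iff.2 (by nlinarith [pow_pos hy 2])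
    linarith
  have hlow : 0.78295 < μ := by
    rw [← hxμ]
    have h1 := lower_aux x hx0
    show 0.78295 < x / (1 - Real.exp (-4 * x ^ 2))
    rw [lt_div_iff₀ (hden x hx0)]
    rw [lt_div_iff₀ (by norm_num)] at h1
    linarith
  have hup : μ ≤ (Real.sqrt 5 / 4) / 0.71349 := by
    have h5 : 0 < Real.sqrt 5 / 4 := by positivity
    have h1 := hlb ⟨Real.sqrt 5 / 4, h5, rfl⟩
    refine h1.trans ?_
    have e : -4 * (Real.sqrt 5 / 4) ^ 2 = -(5 / 4) := by
      rw [div_pow, Real.sq_sqrt (by norm_num)]; norm_num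
    show Real.sqrt 5 / 4 / (1 - Real.exp (-4 * (Real.sqrt 5 / 4) ^ 2)) ≤ _
    rw [e]
    have := exp_upper_aux
    exact div_le_div_of_nonneg_left h5.le (by norm_num) (by linarith)
  have A : 0.613 < μ ^ 2 := by nlinarith
  have B : μ ^ 2 < 0.616 := by
    have h1 : μ ^ 2 ≤ ((Real.sqrt 5 / 4) / 0.71349) ^ 2 :=
      pow_le_pow_left₀ (by linarith) hup 2
    rw [div_pow, div_pow, Real.sq_sqrt (by norm_num)] at h1
    refine h1.trans_lt ?_
    norm_num
  refine ⟨A, B, ?_⟩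
  intro N S hN hS T hT
  have hTS : T ^ 2 * S = μ ^ 2 * N := by
    rw [hT, mul_pow, Real.sq_sqrt (by positivity)]
    field_simp
  rw [hTS]
  exact ⟨rfl, mul_lt_mul_of_pos_right A hN, mul_lt_mul_of_pos_right B hN⟩
end
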